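/- arXiv:1811.07759 — 10 statements merged into one kernel-verified Lean document; each statement's English description precedes it below -/
import Mathlib

section
/- Let R > 0 and let ρ : [0,R] → [0,∞) be integrable, non-increasing, and not almost everywhere zero. Then (5/3)·∫₀^R a⁴ρ(a) da ≤ R²·∫₀^R a²ρ(a) da; equivalently the inertial radius R_I defined by R_I² = (5/3)·(∫₀^R a⁴ρ(a) da)/(∫₀^R a²ρ(a) da) satisfies R_I ≤ R. Moreover equality R_I = R holds if and only if ρ is constant almost everywhere on [0,R]. -/
open MeasureTheory Set

/-- The weight `R² a² - (5/3) a⁴` has mean zero on `[0,R]`, so subtracting a constant from the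
density does not change its weighted integral. -/
theorem integral_weight_mul_sub_const {R : ℝ} {ρ : ℝ → ℝ}
    (hρ : IntervalIntegrable ρ volume 0 R) (c : ℝ) :
    ∫ a in (0:ℝ)..R, (R ^ 2 * a ^ 2 - 5 / 3 * a ^ 4) * (ρ a - c) =
      R ^ 2 * (∫ a in (0:ℝ)..R, a ^ 2 * ρ a) - 5 / 3 * ∫ a in (0:ℝ)..R, a ^ 4 * ρ a := by
  have h₂ : IntervalIntegrable (fun a => R ^ 2 * (a ^ 2 * ρ a)) volume 0 R :=
    (hρ.continuousOn_mul (continuous_pow 2).continuousOn).const_mul _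
  have h₄ : IntervalIntegrable (fun a => 5 / 3 * (a ^ 4 * ρ a)) volume 0 R :=
    (hρ.continuousOn_mul (continuous_pow 4).continuousOn).const_mul _
  have hw₂ : IntervalIntegrable (fun a : ℝ => R ^ 2 * a ^ 2) volume 0 R :=
    Continuous.intervalIntegrable (by fun_prop) _ _
  have hw₄ : IntervalIntegrable (fun a : ℝ => 5 / 3 * a ^ 4) volume 0 R :=
    Continuous.intervalIntegrable (by fun_prop) _ _
  have hw : ∫ a in (0:ℝ)..R, (R ^ 2 * a ^ 2 - 5 / 3 * a ^ 4) = 0 := by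
    rw [intervalIntegral.integral_sub hw₂ hw₄, intervalIntegral.integral_const_mul,
      intervalIntegral.integral_const_mul, integral_pow, integral_pow]
    norm_num
    ring
  calc _ = ∫ a in (0:ℝ)..R, (R ^ 2 * (a ^ 2 * ρ a) - 5 / 3 * (a ^ 4 * ρ a)) -
        c * (R ^ 2 * a ^ 2 - 5 / 3 * a ^ 4) := by
        congr 1
        ext a
        ring
    _ = _ := by
        rw [intervalIntegral.integral_sub (h₂.sub h₄) ((hw₂.sub hw₄).const_mul c),
          intervalIntegral.integral_sub h₂ h₄, intervalIntegral.integral_const_mul,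
          intervalIntegral.integral_const_mul, intervalIntegral.integral_const_mul, hw]
        ring

/-- The weight `R² a² - (5/3) a⁴` changes sign from `+` to `-` at `b` with `b² = (3/5) R²`, so its
product with a non-increasing function centred at `b` is nonnegative. -/
theorem weight_mul_sub_nonneg {R b : ℝ} {ρ : ℝ → ℝ} (hmono : AntitoneOn ρ (Icc 0 R))
    (hb : b ∈ Icc 0 R) (hbR : b ^ 2 = 3 / 5 * R ^ 2) {a : ℝ} (ha : a ∈ Icc 0 R) :
    0 ≤ (R ^ 2 * a ^ 2 - 5 / 3 * a ^ 4) * (ρ a - ρ b) := by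
  have hfac : R ^ 2 * a ^ 2 - 5 / 3 * a ^ 4 = 5 / 3 * a ^ 2 * (b ^ 2 - a ^ 2) := by
    rw [hbR]
    ring
  rw [hfac, mul_assoc]
  refine mul_nonneg (by positivity) ?_
  rcases le_total a b with h | h
  · exact mul_nonneg (sub_nonneg.2 (pow_le_pow_left₀ ha.1 h 2)) (sub_nonneg.2 (hmono ha hb h))
  · exact mul_nonneg_of_nonpos_of_nonpos (sub_nonpos.2 (pow_le_pow_left₀ hb.1 h 2))
      (sub_nonpos.2 (hmono hb ha h))

/-- For an integrable, non-increasing, not a.e. zero density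
`ρ : [0,R] → [0,∞)` one has `(5/3)∫ a⁴ρ ≤ R²∫ a²ρ` (equivalently, the inertial
radius `R_I` with `R_I² = (5/3)(∫a⁴ρ)/(∫a²ρ)` satisfies `R_I ≤ R`), with
equality iff `ρ` is a.e. constant on `[0,R]`. -/
theorem stmt_0 (R : ℝ) (hR : 0 < R) (ρ : ℝ → ℝ)
    (hnn : ∀ r ∈ Icc (0:ℝ) R, 0 ≤ ρ r)
    (hint : IntegrableOn ρ (Icc 0 R))
    (hmono : AntitoneOn ρ (Icc 0 R))
    (hne : ¬ ρ =ᵐ[volume.restrict (Icc (0:ℝ) R)] 0) :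
    (5 / 3) * (∫ a in (0:ℝ)..R, a ^ 4 * ρ a) ≤ R ^ 2 * ∫ a in (0:ℝ)..R, a ^ 2 * ρ a ∧
    Real.sqrt ((5 / 3) * (∫ a in (0:ℝ)..R, a ^ 4 * ρ a) /
        (∫ a in (0:ℝ)..R, a ^ 2 * ρ a)) ≤ R ∧
    ((5 / 3) * (∫ a in (0:ℝ)..R, a ^ 4 * ρ a) = R ^ 2 * ∫ a in (0:ℝ)..R, a ^ 2 * ρ a ↔
      ∃ c : ℝ, ρ =ᵐ[volume.restrict (Icc (0:ℝ) R)] fun _ => c) := by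
  have hρ : IntervalIntegrable ρ volume 0 R :=
    (intervalIntegrable_iff_integrableOn_Icc_of_le hR.le).2 hint
  obtain ⟨b, hb, hbR⟩ : ∃ b ∈ Icc (0:ℝ) R, b ^ 2 = 3 / 5 * R ^ 2 := by
    have hsq : √(3 / 5 * R ^ 2) ^ 2 = 3 / 5 * R ^ 2 := Real.sq_sqrt (by positivity)
    refine ⟨√(3 / 5 * R ^ 2), ⟨Real.sqrt_nonneg _, Real.sqrt_le_iff.2 ⟨hR.le, ?_⟩⟩, hsq⟩
    nlinarith [sq_nonneg R]
  have hnonneg : ∀ a ∈ Icc (0:ℝ) R, 0 ≤ (R ^ 2 * a ^ 2 - 5 / 3 * a ^ 4) * (ρ a - ρ b) :=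
    fun a ha => weight_mul_sub_nonneg hmono hb hbR ha
  have hle : (5 / 3) * (∫ a in (0:ℝ)..R, a ^ 4 * ρ a) ≤
      R ^ 2 * ∫ a in (0:ℝ)..R, a ^ 2 * ρ a := by
    rw [← sub_nonneg, ← integral_weight_mul_sub_const hρ (ρ b)]
    exact intervalIntegral.integral_nonneg hR.le hnonneg
  refine ⟨hle, Real.sqrt_le_iff.2 ⟨hR.le, div_le_of_le_mul₀ ?_ (sq_nonneg R) hle⟩, ?_, ?_⟩
  · exact intervalIntegral.integral_nonneg hR.le fun a ha => mul_nonneg (sq_nonneg a) (hnn a ha)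
  · intro heq
    refine ⟨ρ b, ?_⟩
    have hzero := integral_weight_mul_sub_const hρ (ρ b)
    rw [heq, sub_self, intervalIntegral.integral_of_le hR.le,
      ← integral_Icc_eq_integral_Ioc] at hzero
    have hintw : IntegrableOn (fun a => (R ^ 2 * a ^ 2 - 5 / 3 * a ^ 4) * (ρ a - ρ b))
        (Icc 0 R) := by
      rw [← intervalIntegrable_iff_integrableOn_Icc_of_le hR.le]
      exact (hρ.sub intervalIntegrable_const).continuousOn_mul (by fun_prop)
    rw [setIntegral_eq_zero_iff_of_nonneg_ae
      (ae_restrict_of_forall_mem measurableSet_Icc hnonneg) hintw] at hzero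
    filter_upwards [hzero, ae_restrict_mem measurableSet_Icc,
      Measure.ae_ne (volume.restrict (Icc 0 R)) 0,
      Measure.ae_ne (volume.restrict (Icc 0 R)) b] with a ha hmem ha0 hab
    have hfac : R ^ 2 * a ^ 2 - 5 / 3 * a ^ 4 = 5 / 3 * a ^ 2 * (b ^ 2 - a ^ 2) := by
      rw [hbR]
      ring
    have hsq : b ^ 2 - a ^ 2 ≠ 0 :=
      sub_ne_zero.2 fun h => hab ((sq_eq_sq₀ hb.1 hmem.1).1 h).symm
    refine sub_eq_zero.1 ((mul_eq_zero.1 ha).resolve_left ?_)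
    rw [hfac]
    positivity
  · rintro ⟨c, hc⟩
    refine (sub_eq_zero.1 ?_).symm
    rw [← integral_weight_mul_sub_const hρ c, intervalIntegral.integral_of_le hR.le,
      ← integral_Icc_eq_integral_Ioc]
    refine integral_eq_zero_of_ae ?_
    filter_upwards [hc] with a ha
    simp [ha]
end

section
/- Assume ρ : [0,∞) → ℝ is C², non-increasing, with ρ(r) > 0 for 0 ≤ r < R and ρ(r) = 0 for r ≥ R. Let ε be the unique bounded solution of Clairaut's integral equation for some Ω > 0, and define w(r) = (1/5)∫_r^∞ ρ′(a)ε(a) da − Ω²/(8πG), y(r) = (1/(5r⁵))∫₀^r a⁵ρ′(a)ε(a) da + (1/5)∫_r^∞ ρ′(a)ε(a) da − Ω²/(8πG), and v = w/y. Then v is continuous on [0,R] with v(0) = 1, v satisfies the Riccati equation v′(r) = (5/r)·v(r)(1 − v(r)) + (3/5)·ρ′(r)/ρ̄(r) for 0 < r < R, and γ/γ_I = (3/2)·(R_I/R)⁵·v(R)/(1 − v(R)), where γ = −15·I₀·Ω²/(8π·∫₀^R a⁵ε(a)ρ′(a) da). -/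
open MeasureTheory Set Real

/-- The mean density inside radius `r`: `ρ̄(r) = (3/r³)∫₀^r a²ρ(a) da`, with `ρ̄(0) = ρ(0)`. -/
noncomputable def rhoBar (ρ : ℝ → ℝ) (r : ℝ) : ℝ :=
  if r = 0 then ρ 0 else (3 / r ^ 3) * ∫ a in (0:ℝ)..r, a ^ 2 * ρ a

/-- The mass `m = 4π∫₀^R a²ρ(a) da`. -/
noncomputable def massOf (ρ : ℝ → ℝ) (R : ℝ) : ℝ :=
  4 * π * ∫ a in (0:ℝ)..R, a ^ 2 * ρ a

/-- The mean moment of inertia `I₀ = (8π/3)∫₀^R a⁴ρ(a) da`. -/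
noncomputable def inertiaOf (ρ : ℝ → ℝ) (R : ℝ) : ℝ :=
  (8 * π / 3) * ∫ a in (0:ℝ)..R, a ^ 4 * ρ a

/-- The inertial radius `R_I = √(5I₀/(2m))`. -/
noncomputable def RIof (ρ : ℝ → ℝ) (R : ℝ) : ℝ :=
  Real.sqrt (5 * inertiaOf ρ R / (2 * massOf ρ R))

/-- `γ_I = (4/5) G m / R_I³`. -/
noncomputable def gammaIof (G : ℝ) (ρ : ℝ → ℝ) (R : ℝ) : ℝ :=
  (4 / 5) * G * massOf ρ R / RIof ρ R ^ 3

/-- The gravitational rigidity modulus `γ = −15 I₀ Ω²/(8π ∫₀^R a⁵ε ρ′ da)`. -/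
noncomputable def gammaOf (Ω : ℝ) (ρ ε : ℝ → ℝ) (R : ℝ) : ℝ :=
  -(15 * inertiaOf ρ R * Ω ^ 2) / (8 * π * ∫ a in (0:ℝ)..R, a ^ 5 * ε a * deriv ρ a)

/-- Clairaut's integral equation, for all `r > 0`. -/
noncomputable def ClairautEq (G Ω : ℝ) (ρ ε : ℝ → ℝ) : Prop :=
  ∀ r : ℝ, 0 < r →
    4 * π * G *
      (ε r * r ^ 2 * (∫ a in (0:ℝ)..r, a ^ 2 * ρ a)
        + (1 / 5) * (∫ a in (0:ℝ)..r, a ^ 5 * ε a * deriv ρ a)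
        + (r ^ 5 / 5) * (∫ a in Ioi r, ε a * deriv ρ a)) = Ω ^ 2 * r ^ 5 / 2

open Filter Topology

lemma deriv_nonpos_of_antitoneOn_Ici {ρ : ℝ → ℝ} (hmono : AntitoneOn ρ (Ici 0)) {r : ℝ}
    (hr : 0 < r) : deriv ρ r ≤ 0 := by
  rw [← derivWithin_of_mem_nhds (Ici_mem_nhds hr)]
  exact hmono.derivWithin_nonpos

lemma deriv_eq_zero_of_forall_ge {ρ : ℝ → ℝ} {R : ℝ} (hzero : ∀ r : ℝ, R ≤ r → ρ r = 0) {r : ℝ}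
    (hr : R < r) : deriv ρ r = 0 := by
  have h : ρ =ᶠ[𝓝 r] fun _ => (0 : ℝ) := by
    filter_upwards [Ioi_mem_nhds hr] with a ha using hzero a (le_of_lt ha)
  rw [h.deriv_eq, deriv_const]

/-- A continuous function vanishing beyond `R` times a function bounded on `[0,∞)` is bounded
on `[0,∞)`. -/
lemma exists_bound_mul {f ε : ℝ → ℝ} {R : ℝ} (hf : Continuous f)
    (hzero : ∀ r : ℝ, R < r → f r = 0) (hε : ∃ C : ℝ, ∀ r : ℝ, 0 ≤ r → |ε r| ≤ C) :
    ∃ C : ℝ, 0 ≤ C ∧ ∀ r : ℝ, 0 ≤ r → |f r * ε r| ≤ C := by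
  obtain ⟨C, hC⟩ := hε
  obtain ⟨B, hB⟩ := (isCompact_Icc (a := (0 : ℝ)) (b := R)).exists_bound_of_continuousOn
    hf.continuousOn
  have hC0 : 0 ≤ C := (abs_nonneg _).trans (hC 0 le_rfl)
  refine ⟨|B| * C, by positivity, fun r hr => ?_⟩
  rcases le_or_gt r R with h | h
  · rw [abs_mul]
    exact mul_le_mul ((hB r ⟨hr, h⟩).trans (le_abs_self B)) (hC r hr) (abs_nonneg _)
      (abs_nonneg _)
  · rw [hzero r h, zero_mul, abs_zero]
    positivity

lemma intervalIntegrable_of_abs_le {g : ℝ → ℝ} (hg : Measurable g) {C : ℝ}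
    (hC : ∀ r : ℝ, 0 ≤ r → |g r| ≤ C) {a b : ℝ} (ha : 0 ≤ a) (hb : 0 ≤ b) :
    IntervalIntegrable g volume a b := by
  refine (intervalIntegrable_const (c := C)).mono_fun hg.aestronglyMeasurable ?_
  filter_upwards [ae_restrict_mem measurableSet_uIoc] with x hx
  have hx0 : 0 ≤ x := (le_min ha hb).trans hx.1.le
  exact (hC x hx0).trans (le_abs_self C)

lemma setIntegral_Ioi_eq_intervalIntegral {g : ℝ → ℝ} {R : ℝ} (hg : ∀ a : ℝ, R < a → g a = 0)
    {r : ℝ} (hr : r ≤ R) : ∫ a in Ioi r, g a = ∫ a in r..R, g a := by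
  rw [intervalIntegral.integral_of_le hr]
  refine setIntegral_eq_of_subset_of_forall_sdiff_eq_zero measurableSet_Ioi
    (fun x hx => hx.1) fun x hx => hg x ?_
  by_contra h
  exact hx.2 ⟨hx.1, not_lt.mp h⟩

lemma hasDerivAt_integral_sq_mul {ρ : ℝ → ℝ} (hρ : Continuous ρ) (r : ℝ) :
    HasDerivAt (fun r => ∫ a in (0 : ℝ)..r, a ^ 2 * ρ a) (r ^ 2 * ρ r) r :=
  intervalIntegral.integral_hasDerivAt_right ((by fun_prop : Continuous fun a : ℝ =>
    a ^ 2 * ρ a).intervalIntegrable _ _) ((by fun_prop : Continuous fun a : ℝ =>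
    a ^ 2 * ρ a).stronglyMeasurableAtFilter _ _) (by fun_prop)

lemma integral_sq_mul_const (c r : ℝ) : ∫ a in (0 : ℝ)..r, a ^ 2 * c = r ^ 3 / 3 * c := by
  rw [intervalIntegral.integral_mul_const, integral_pow]
  norm_num

lemma cube_mul_le_integral_sq_mul {ρ : ℝ → ℝ} (hρ : Continuous ρ)
    (hmono : AntitoneOn ρ (Ici 0)) {r : ℝ} (hr : 0 ≤ r) :
    r ^ 3 * ρ r ≤ 3 * ∫ a in (0 : ℝ)..r, a ^ 2 * ρ a := by
  have h : ∫ a in (0 : ℝ)..r, a ^ 2 * ρ r ≤ ∫ a in (0 : ℝ)..r, a ^ 2 * ρ a := by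
    refine intervalIntegral.integral_mono_on hr
      (Continuous.intervalIntegrable (by fun_prop) _ _)
      (Continuous.intervalIntegrable (by fun_prop) _ _) fun x hx => ?_
    exact mul_le_mul_of_nonneg_left (hmono hx.1 hr hx.2) (by positivity)
  rw [integral_sq_mul_const] at h
  linarith

lemma integral_sq_mul_le {ρ : ℝ → ℝ} (hρ : Continuous ρ)
    (hmono : AntitoneOn ρ (Ici 0)) {r : ℝ} (hr : 0 ≤ r) :
    3 * ∫ a in (0 : ℝ)..r, a ^ 2 * ρ a ≤ r ^ 3 * ρ 0 := by
  have h : ∫ a in (0 : ℝ)..r, a ^ 2 * ρ a ≤ ∫ a in (0 : ℝ)..r, a ^ 2 * ρ 0 := by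
    refine intervalIntegral.integral_mono_on hr
      (Continuous.intervalIntegrable (by fun_prop) _ _)
      (Continuous.intervalIntegrable (by fun_prop) _ _) fun x hx => ?_
    exact mul_le_mul_of_nonneg_left (hmono (mem_Ici.mpr le_rfl) hx.1 hx.1) (by positivity)
  rw [integral_sq_mul_const] at h
  linarith

lemma integral_pow_mul_pos {ρ : ℝ → ℝ} {R : ℝ} (n : ℕ) (hρ : Continuous ρ)
    (hpos : ∀ r : ℝ, 0 ≤ r → r < R → 0 < ρ r) {r : ℝ} (hr : 0 < r) (hrR : r ≤ R) :
    0 < ∫ a in (0 : ℝ)..r, a ^ n * ρ a :=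
  intervalIntegral.intervalIntegral_pos_of_pos_on
    (Continuous.intervalIntegrable (by fun_prop) _ _)
    (fun x hx => mul_pos (pow_pos hx.1 n) (hpos x hx.1.le (hx.2.trans_le hrR))) hr

/-- The potential coefficients `w` and `y = -ε M / r³` of a bounded solution of Clairaut's
equation have the same sign: `M² ε ε′` is non-decreasing and vanishes at the origin. -/
lemma clairaut_mul_nonneg {R K : ℝ} {ρ d M w y ε : ℝ → ℝ}
    (hρ : ∀ r ∈ Ioo 0 R, HasDerivAt ρ (d r) r)
    (hM : ∀ r ∈ Ioo 0 R, HasDerivAt M (r ^ 2 * ρ r) r)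
    (hw : ∀ r ∈ Ioo 0 R, HasDerivAt w (-(d r * ε r) / 5) r)
    (hy : ∀ r ∈ Ioo 0 R, HasDerivAt y (5 * (w r - y r) / r) r)
    (hyε : ∀ r ∈ Ioo 0 R, y r = -(ε r * M r / r ^ 3))
    (hρ0 : ∀ r ∈ Ioo 0 R, 0 ≤ ρ r) (hM0 : ∀ r ∈ Ioo 0 R, 0 < M r)
    (hMρ : ∀ r ∈ Ioo 0 R, r ^ 3 * ρ r ≤ 3 * M r)
    (hMK : ∀ r ∈ Ioo 0 R, M r ≤ r ^ 3 * K)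
    (hwK : ∀ r ∈ Ioo 0 R, |w r| ≤ K) (hεK : ∀ r ∈ Ioo 0 R, |ε r| ≤ K)
    {r : ℝ} (hr : r ∈ Ioo 0 R) : 0 ≤ w r * y r := by
  have hK : 0 ≤ K := (abs_nonneg _).trans (hwK r hr)
  set u : ℝ → ℝ := fun r => -5 * w r - ε r * (2 * M r / r ^ 3 + ρ r) with hu
  set P : ℝ → ℝ := fun r =>
    (-5 * w r * (r ^ 2 * M r) - ε r * (2 * M r ^ 2 / r + r ^ 2 * M r * ρ r)) * ε r with hP
  have hPu : ∀ r ∈ Ioo 0 R, P r = r ^ 2 * M r * u r * ε r := by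
    intro r hr
    have := hr.1.ne'
    simp only [hP, hu]
    field_simp
  have hε' : ∀ r ∈ Ioo 0 R, HasDerivAt ε (r ^ 2 * u r / M r) r := by
    intro r hr
    have hr0 := hr.1.ne'
    have hMr := (hM0 r hr).ne'
    have h := (((hy r hr).mul ((hasDerivAt_id r).pow 3)).div (hM r hr) hMr).neg
    have hEq : ε =ᶠ[𝓝 r] -(y * id ^ 3 / M) := by
      filter_upwards [Ioo_mem_nhds hr.1 hr.2] with a ha
      have ha0 := ha.1.ne'
      have hMa := (hM0 a ha).ne'
      simp only [Pi.neg_apply, Pi.div_apply, Pi.mul_apply, Pi.pow_apply, id, hyε a ha]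
      field_simp
    refine (h.congr_of_eventuallyEq hEq).congr_deriv ?_
    simp only [hu, Pi.mul_apply, Pi.pow_apply, id, hyε r hr]
    field_simp
    ring
  have hP' : ∀ r ∈ Ioo 0 R, HasDerivAt P
      (r ^ 4 * u r ^ 2 + 2 * M r * (3 * M r - r ^ 3 * ρ r) / r ^ 2 * ε r ^ 2) r := by
    intro r hr
    have hr0 := hr.1.ne'
    have hMr := (hM0 r hr).ne'
    have hsq := (hasDerivAt_id r).pow 2
    have h1 := ((hw r hr).const_mul (-5)).mul (hsq.mul (hM r hr))
    have h2 := ((((hM r hr).pow 2).const_mul 2).div (hasDerivAt_id r) hr0).add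
      ((hsq.mul (hM r hr)).mul (hρ r hr))
    refine ((h1.sub ((hε' r hr).mul h2)).mul (hε' r hr)).congr_deriv ?_
    simp only [hu, Pi.mul_apply, Pi.add_apply, Pi.sub_apply, Pi.div_apply, Pi.pow_apply, id]
    field_simp
    ring
  have hPmono : MonotoneOn P (Ioo 0 R) := by
    refine monotoneOn_of_hasDerivWithinAt_nonneg (convex_Ioo 0 R)
      (fun r hr => (hP' r hr).continuousAt.continuousWithinAt)
      (fun r hr => (hP' r (interior_subset hr)).hasDerivWithinAt) fun r hr => ?_
    rw [interior_Ioo] at hr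
    have h1 := hr.1
    have h2 := hM0 r hr
    have h3 := sub_nonneg.mpr (hMρ r hr)
    positivity
  have hPbound : ∀ r ∈ Ioo 0 R, -(r ^ 5 * (5 * K ^ 3 + 5 * K ^ 4)) ≤ P r := by
    intro r hr
    have hr0 := hr.1
    have hMr := hM0 r hr
    have hρr := hρ0 r hr
    have e1 : -(K * K) ≤ -(w r * ε r) := by
      have := mul_le_mul (hwK r hr) (hεK r hr) (abs_nonneg _) hK
      rw [← abs_mul] at this
      linarith [le_abs_self (w r * ε r)]
    have e2 : ε r ^ 2 ≤ K ^ 2 := sq_le_sq' (by linarith [neg_abs_le (ε r), hεK r hr])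
      (by linarith [le_abs_self (ε r), hεK r hr])
    have e3 : 2 * M r / r ^ 3 + ρ r ≤ 5 * K := by
      have a1 : M r / r ^ 3 ≤ K := by
        rw [div_le_iff₀ (by positivity)]; linarith [hMK r hr]
      have a2 : ρ r ≤ 3 * (M r / r ^ 3) := by
        rw [← mul_div_assoc, le_div_iff₀ (by positivity)]; linarith [hMρ r hr]
      have a3 : 2 * M r / r ^ 3 = 2 * (M r / r ^ 3) := by ring
      linarith
    have e4 : ε r ^ 2 * (2 * M r / r ^ 3 + ρ r) ≤ K ^ 2 * (5 * K) :=
      mul_le_mul e2 e3 (by positivity) (by positivity)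
    have e5 : -(5 * K ^ 2 + 5 * K ^ 3) ≤ u r * ε r := by
      simp only [hu]; nlinarith
    have e6 : r ^ 2 * M r ≤ r ^ 5 * K := by
      have := mul_le_mul_of_nonneg_left (hMK r hr) (by positivity : 0 ≤ r ^ 2)
      nlinarith
    rw [hPu r hr]
    have e7 : r ^ 2 * M r * (5 * K ^ 2 + 5 * K ^ 3) ≤ r ^ 5 * K * (5 * K ^ 2 + 5 * K ^ 3) :=
      mul_le_mul_of_nonneg_right e6 (by positivity)
    have e8 := mul_le_mul_of_nonneg_left e5 (by positivity : 0 ≤ r ^ 2 * M r)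
    nlinarith
  have hP0 : 0 ≤ P r := by
    have hlim : Tendsto (fun s : ℝ => -(s ^ 5 * (5 * K ^ 3 + 5 * K ^ 4))) (𝓝[>] 0) (𝓝 0) := by
      have : Continuous fun s : ℝ => -(s ^ 5 * (5 * K ^ 3 + 5 * K ^ 4)) := by fun_prop
      simpa using (this.tendsto 0).mono_left nhdsWithin_le_nhds
    refine le_of_tendsto hlim ?_
    filter_upwards [Ioo_mem_nhdsGT hr.1] with s hs
    have hsR : s ∈ Ioo 0 R := ⟨hs.1, hs.2.trans hr.2⟩
    exact (hPbound s hsR).trans (hPmono hsR hr hs.2.le)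
  have hr0 := hr.1
  have hMr := hM0 r hr
  have hρr := hρ0 r hr
  have huε : 0 ≤ u r * ε r := by
    rw [hPu r hr, mul_assoc] at hP0
    exact nonneg_of_mul_nonneg_right hP0 (by positivity)
  have hwε : 0 ≤ -(w r * ε r) := by
    have : 0 ≤ ε r ^ 2 * (2 * M r / r ^ 3 + ρ r) := by positivity
    simp only [hu] at huε
    nlinarith
  rw [hyε r hr]
  have : w r * -(ε r * M r / r ^ 3) = -(w r * ε r) * (M r / r ^ 3) := by ring
  rw [this]
  positivity

/-- `w²` is non-increasing, so `w` keeps the sign it has at the surface. -/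
lemma clairaut_neg {R : ℝ} {d w y ε M : ℝ → ℝ} (hR : 0 < R)
    (hw : ∀ r ∈ Ioo 0 R, HasDerivAt w (-(d r * ε r) / 5) r) (hwc : ContinuousOn w (Icc 0 R))
    (hyε : ∀ r ∈ Ioo 0 R, y r = -(ε r * M r / r ^ 3)) (hM0 : ∀ r ∈ Ioo 0 R, 0 < M r)
    (hd : ∀ r ∈ Ioo 0 R, d r ≤ 0) (hwy : ∀ r ∈ Ioo 0 R, 0 ≤ w r * y r) (hwR : w R < 0)
    {r : ℝ} (hr : r ∈ Icc 0 R) : w r < 0 := by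
  have hanti : AntitoneOn (fun r => w r ^ 2) (Icc 0 R) := by
    refine antitoneOn_of_hasDerivWithinAt_nonpos (convex_Icc 0 R) (hwc.pow 2)
      (fun r hr => ((hw r (interior_Icc (a := (0 : ℝ)) ▸ hr)).pow 2).hasDerivWithinAt)
      fun r hr => ?_
    rw [interior_Icc] at hr
    have h1 := hwy r hr
    have hr0 := hr.1
    have hMr := hM0 r hr
    have h2 : w r * y r = -(w r * ε r) * (M r / r ^ 3) := by rw [hyε r hr]; ring
    rw [h2] at h1
    have h3 : 0 ≤ -(w r * ε r) := nonneg_of_mul_nonneg_left h1 (by positivity)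
    have h4 := mul_nonneg h3 (neg_nonneg.mpr (hd r hr))
    norm_num
    nlinarith
  have hne : ∀ s ∈ Icc 0 R, w s ≠ 0 := by
    intro s hs h0
    have h := hanti hs (right_mem_Icc.mpr hR.le) hs.2
    simp only [h0] at h
    nlinarith
  by_contra! h
  obtain ⟨s, hs, hs0⟩ := intermediate_value_Icc' hr.2
    (hwc.mono (Icc_subset_Icc_left hr.1)) ⟨hwR.le, h⟩
  exact hne s ⟨hr.1.trans hs.1, hs.2⟩ hs0

/-- `r⁵y` vanishes at the origin and has derivative `5r⁴w`, so `y` inherits the sign of `w`. -/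
lemma clairaut_potential_neg {R : ℝ} {w y : ℝ → ℝ}
    (hy : ∀ r ∈ Ioo 0 R, HasDerivAt y (5 * (w r - y r) / r) r)
    (hyc : ContinuousOn y (Icc 0 R)) (hw0 : ∀ r ∈ Ioo 0 R, w r < 0) (hy0 : y 0 < 0)
    {r : ℝ} (hr : r ∈ Icc 0 R) : y r < 0 := by
  rcases hr.1.eq_or_lt with rfl | hr0
  · exact hy0
  have hanti : StrictAntiOn (fun r => r ^ 5 * y r) (Icc 0 R) := by
    refine strictAntiOn_of_hasDerivWithinAt_neg (f' := fun r => 5 * r ^ 4 * w r)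
      (convex_Icc 0 R) ((continuousOn_id.pow 5).mul hyc) (fun r hr => ?_) fun r hr => ?_ <;>
      rw [interior_Icc] at hr
    · have hr0 := hr.1.ne'
      refine (((hasDerivAt_id r).pow 5).mul (hy r hr)).hasDerivWithinAt.congr_deriv ?_
      simp only [Pi.pow_apply, id]
      field_simp
      ring
    · have hr0 := hr.1
      exact mul_neg_of_pos_of_neg (by positivity) (hw0 r hr)
  have h := hanti (left_mem_Icc.mpr (hr.1.trans hr.2)) hr hr0
  simp only [ne_eq, OfNat.ofNat_ne_zero, not_false_eq_true, zero_pow, zero_mul] at h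
  exact neg_of_mul_neg_right h (by positivity)

lemma continuousOn_primitive {g : ℝ → ℝ} {R : ℝ} (hR : 0 ≤ R)
    (hg : IntervalIntegrable g volume 0 R) :
    ContinuousOn (fun r => ∫ a in (0 : ℝ)..r, g a) (Icc 0 R) := by
  have := intervalIntegral.continuousOn_primitive_interval' hg left_mem_uIcc
  rwa [uIcc_of_le hR] at this

lemma abs_integral_pow_mul_le {g : ℝ → ℝ} {C : ℝ}
    (hC : ∀ r : ℝ, 0 ≤ r → |g r| ≤ C) (n : ℕ) {r : ℝ} (hr : 0 ≤ r) :
    |∫ a in (0 : ℝ)..r, a ^ n * g a| ≤ r ^ n * C * r := by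
  have h := intervalIntegral.norm_integral_le_of_norm_le_const (a := 0) (b := r)
    (f := fun a => a ^ n * g a) (C := r ^ n * C) fun x hx => ?_
  · simpa [abs_of_nonneg hr] using h
  · rw [uIoc_of_le hr] at hx
    rw [Real.norm_eq_abs, abs_mul, abs_of_nonneg (pow_nonneg hx.1.le n)]
    exact mul_le_mul (pow_le_pow_left₀ hx.1.le hx.2 n) (hC x hx.1.le) (abs_nonneg _)
      (by positivity)

lemma continuousWithinAt_zero_div_pow {A : ℝ → ℝ} {C R : ℝ}
    (hA : ∀ r : ℝ, 0 ≤ r → |A r| ≤ r ^ 5 * C * r) :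
    ContinuousWithinAt (fun r => 1 / (5 * r ^ 5) * A r) (Icc 0 R) 0 := by
  have hlim : Tendsto (fun s : ℝ => C * s) (𝓝[Icc 0 R] 0) (𝓝 0) := by
    have : Continuous fun s : ℝ => C * s := by fun_prop
    simpa using (this.tendsto 0).mono_left nhdsWithin_le_nhds
  have h0 : 1 / (5 * (0 : ℝ) ^ 5) * A 0 = 0 := by simp
  rw [ContinuousWithinAt, h0]
  refine squeeze_zero_norm' ?_ hlim
  filter_upwards [self_mem_nhdsWithin] with s hs
  rcases hs.1.eq_or_lt with rfl | hs0
  · simp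
  · have h := hA s hs.1
    rw [Real.norm_eq_abs, abs_mul, abs_of_pos (by positivity), one_div_mul_eq_div,
      div_le_iff₀ (by positivity)]
    nlinarith [(abs_nonneg _).trans h]

/-- With `w`, `y`, `v = w/y` built from the bounded Clairaut solution
`ε`, the function `v` is continuous on `[0,R]`, `v(0) = 1`, satisfies the Riccati
equation `v′ = (5/r)v(1−v) + (3/5)ρ′/ρ̄` on `(0,R)`, and
`γ/γ_I = (3/2)(R_I/R)⁵ v(R)/(1 − v(R))`. -/
theorem stmt_7 (R G Ω : ℝ) (hR : 0 < R) (hG : 0 < G) (hΩ : 0 < Ω)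
    (ρ : ℝ → ℝ) (hC2 : ContDiff ℝ 2 ρ) (hmono : AntitoneOn ρ (Ici 0))
    (hpos : ∀ r : ℝ, 0 ≤ r → r < R → 0 < ρ r) (hzero : ∀ r : ℝ, R ≤ r → ρ r = 0)
    (ε : ℝ → ℝ) (hεmeas : Measurable ε) (hεbd : ∃ C : ℝ, ∀ r : ℝ, 0 ≤ r → |ε r| ≤ C)
    (hcl : ClairautEq G Ω ρ ε)
    (w y v : ℝ → ℝ)
    (hw : ∀ r : ℝ, w r = (1 / 5) * (∫ a in Ioi r, deriv ρ a * ε a) - Ω ^ 2 / (8 * π * G))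
    (hy : ∀ r : ℝ, y r = (1 / (5 * r ^ 5)) * (∫ a in (0:ℝ)..r, a ^ 5 * deriv ρ a * ε a)
        + (1 / 5) * (∫ a in Ioi r, deriv ρ a * ε a) - Ω ^ 2 / (8 * π * G))
    (hv : ∀ r : ℝ, v r = w r / y r) :
    ContinuousOn v (Icc 0 R) ∧ v 0 = 1 ∧
    (∀ r ∈ Ioo (0:ℝ) R,
      HasDerivAt v ((5 / r) * v r * (1 - v r) + (3 / 5) * deriv ρ r / rhoBar ρ r) r) ∧
    gammaOf Ω ρ ε R / gammaIof G ρ R =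
      (3 / 2) * (RIof ρ R / R) ^ 5 * v R / (1 - v R) := by
  set k : ℝ := Ω ^ 2 / (8 * π * G) with hk
  have hkpos : 0 < k := by positivity
  have hρc : Continuous ρ := hC2.continuous
  have hdc : Continuous (deriv ρ) := hC2.continuous_deriv (by norm_num)
  have hd0 : ∀ r, R < r → deriv ρ r = 0 := fun r hr => deriv_eq_zero_of_forall_ge hzero hr
  obtain ⟨C, hC0, hC⟩ := exists_bound_mul hdc hd0 hεbd
  set g : ℝ → ℝ := fun a => deriv ρ a * ε a with hg
  have hgm : Measurable g := hdc.measurable.mul hεmeas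
  have hgi : ∀ {a b : ℝ}, 0 ≤ a → 0 ≤ b → IntervalIntegrable g volume a b :=
    fun ha hb => intervalIntegrable_of_abs_le hgm hC ha hb
  have hfi : ∀ {a b : ℝ}, 0 ≤ a → 0 ≤ b →
      IntervalIntegrable (fun a => a ^ 5 * g a) volume a b :=
    fun ha hb => (hgi ha hb).continuousOn_mul (by fun_prop)
  set A : ℝ → ℝ := fun r => ∫ a in (0 : ℝ)..r, a ^ 5 * g a with hA
  set M : ℝ → ℝ := fun r => ∫ a in (0 : ℝ)..r, a ^ 2 * ρ a with hM
  have hAε : ∀ r : ℝ, ∫ a in (0 : ℝ)..r, a ^ 5 * ε a * deriv ρ a = A r := fun r => by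
    simp only [hA, hg]
    congr 1; ext a; ring
  have hyw : ∀ r, y r = 1 / (5 * r ^ 5) * A r + w r := fun r => by
    rw [hy, hw, ← add_sub_assoc]
    simp only [hA, hg, mul_assoc]
  have hMpos : ∀ r, 0 < r → r ≤ R → 0 < M r := fun r hr hrR =>
    integral_pow_mul_pos 2 hρc hpos hr hrR
  have hyε : ∀ r ∈ Ioo 0 R, y r = -(ε r * M r / r ^ 3) := fun r hr => by
    have hr0 := hr.1.ne'
    have h := hcl r hr.1
    have hB : ∫ a in Ioi r, ε a * deriv ρ a = 5 * (w r + k) := by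
      rw [hw r]
      simp only [mul_comm (ε _)]
      ring
    rw [hAε, hB] at h
    rw [hyw]
    have hk' : Ω ^ 2 = k * (8 * π * G) := by rw [hk]; field_simp
    rw [hk'] at h
    have h' : ε r * r ^ 2 * M r + 1 / 5 * A r + r ^ 5 * w r = 0 := by
      have : 4 * π * G * (ε r * r ^ 2 * M r + 1 / 5 * A r + r ^ 5 * w r) = 0 := by
        linear_combination h
      exact (mul_eq_zero.mp this).resolve_left (by positivity)
    field_simp
    linear_combination 5 * h'
  have hwIcc : ∀ r ∈ Icc 0 R,
      w r = (1 / 5) * ((∫ a in (0 : ℝ)..R, g a) - ∫ a in (0 : ℝ)..r, g a) - k := fun r hr => by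
    rw [intervalIntegral.integral_interval_sub_left (hgi le_rfl hR.le) (hgi le_rfl hr.1), hw r,
      setIntegral_Ioi_eq_intervalIntegral (fun a ha => by rw [hd0 a ha, zero_mul]) hr.2]
  have hwc : ContinuousOn w (Icc 0 R) := by
    refine ContinuousOn.congr ?_ hwIcc
    exact (continuousOn_const.mul (continuousOn_const.sub
      (continuousOn_primitive hR.le (hgi le_rfl hR.le)))).sub continuousOn_const
  have hwR : w R = -k := by rw [hwIcc R (right_mem_Icc.mpr hR.le)]; ring
  have hAc : ContinuousOn A (Icc 0 R) := continuousOn_primitive hR.le (hfi le_rfl hR.le)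
  have hAw : ContinuousOn (fun r => 1 / (5 * r ^ 5) * A r) (Icc 0 R) := by
    intro r hr
    rcases hr.1.eq_or_lt with rfl | hr0
    · exact continuousWithinAt_zero_div_pow fun s hs => abs_integral_pow_mul_le hC 5 hs
    · refine ContinuousWithinAt.mul (ContinuousAt.continuousWithinAt ?_) (hAc r hr)
      fun_prop (disch := positivity)
  have hyc : ContinuousOn y (Icc 0 R) := by
    rw [show y = fun r => 1 / (5 * r ^ 5) * A r + w r from funext hyw]
    exact hAw.add hwc
  have hIcc : ∀ r ∈ Ioo 0 R, Icc 0 R ∈ 𝓝 r := fun r hr => Icc_mem_nhds hr.1 hr.2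
  have hM' : ∀ r, HasDerivAt M (r ^ 2 * ρ r) r := hasDerivAt_integral_sq_mul hρc
  have hεc : ∀ r ∈ Ioo 0 R, ContinuousAt ε r := fun r hr => by
    have hMr := (hMpos r hr.1 hr.2.le).ne'
    have hEq : ε =ᶠ[𝓝 r] fun a => -(y a * a ^ 3 / M a) := by
      filter_upwards [Ioo_mem_nhds hr.1 hr.2] with a ha
      have ha0 := ha.1.ne'
      have hMa := (hMpos a ha.1 ha.2.le).ne'
      rw [hyε a ha]
      field_simp
    refine ContinuousAt.congr ?_ hEq.symm
    exact (((hyc.continuousAt (hIcc r hr)).mul (continuousAt_id.pow 3)).div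
      (hM' r).continuousAt hMr).neg
  have hgc : ∀ r ∈ Ioo 0 R, ContinuousAt g r := fun r hr => hdc.continuousAt.mul (hεc r hr)
  have hw' : ∀ r ∈ Ioo 0 R, HasDerivAt w (-(deriv ρ r * ε r) / 5) r := fun r hr => by
    have h := intervalIntegral.integral_hasDerivAt_right (hgi le_rfl hr.1.le)
      hgm.stronglyMeasurable.stronglyMeasurableAtFilter (hgc r hr)
    refine ((((h.const_sub _).const_mul (1 / 5)).sub_const k).congr_of_eventuallyEq
      (by filter_upwards [hIcc r hr] with a ha using hwIcc a ha)).congr_deriv ?_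
    simp only [hg]
    ring
  have hA' : ∀ r ∈ Ioo 0 R, HasDerivAt A (r ^ 5 * g r) r := fun r hr =>
    intervalIntegral.integral_hasDerivAt_right (hfi le_rfl hr.1.le)
      ((measurable_id.pow_const 5).mul hgm).stronglyMeasurable.stronglyMeasurableAtFilter
      ((continuousAt_id.pow 5).mul (hgc r hr))
  have hy' : ∀ r ∈ Ioo 0 R, HasDerivAt y (5 * (w r - y r) / r) r := fun r hr => by
    have hr0 := hr.1.ne'
    have h := ((hA' r hr).div (((hasDerivAt_id r).pow 5).const_mul 5)
      (by simpa using hr0)).add (hw' r hr)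
    refine (h.congr_of_eventuallyEq (Eventually.of_forall fun a => ?_)).congr_deriv ?_
    · simp only [hyw a, Pi.add_apply, Pi.div_apply, Pi.pow_apply, id]
      ring
    · simp only [hyw r, Pi.pow_apply, id, hg]
      field_simp
      ring
  obtain ⟨C₁, hC₁⟩ := hεbd
  obtain ⟨C₂, hC₂⟩ := (isCompact_Icc (a := (0 : ℝ)) (b := R)).exists_bound_of_continuousOn hwc
  have hwy : ∀ r ∈ Ioo 0 R, 0 ≤ w r * y r := fun r hr =>
    clairaut_mul_nonneg (K := max (max C₁ C₂) (ρ 0))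
      (fun r _ => ((hC2.differentiable (by norm_num)) r).hasDerivAt)
      (fun r _ => hM' r) hw' hy' hyε (fun r hr => (hpos r hr.1.le hr.2).le)
      (fun r hr => hMpos r hr.1 hr.2.le)
      (fun r hr => cube_mul_le_integral_sq_mul hρc hmono hr.1.le)
      (fun r hr => by
        have h1 := integral_sq_mul_le hρc hmono hr.1.le
        have h2 := hMpos r hr.1 hr.2.le
        have h3 := mul_le_mul_of_nonneg_left (le_max_right (max C₁ C₂) (ρ 0))
          (pow_nonneg hr.1.le 3)
        simp only [hM] at h2 ⊢
        linarith)
      (fun r hr => (hC₂ r ⟨hr.1.le, hr.2.le⟩).trans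
        ((le_max_right _ _).trans (le_max_left _ _)))
      (fun r hr => (hC₁ r hr.1.le).trans ((le_max_left _ _).trans (le_max_left _ _))) hr
  have hwneg : ∀ r ∈ Icc 0 R, w r < 0 := fun r hr =>
    clairaut_neg hR hw' hwc hyε (fun r hr => hMpos r hr.1 hr.2.le)
      (fun r hr => deriv_nonpos_of_antitoneOn_Ici hmono hr.1) hwy (by rw [hwR]; linarith) hr
  have hy0 : y 0 = w 0 := by rw [hyw]; simp
  have hw0 := hwneg 0 (left_mem_Icc.mpr hR.le)
  have hyneg : ∀ r ∈ Icc 0 R, y r < 0 := fun r hr =>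
    clairaut_potential_neg hy' hyc (fun r hr => hwneg r ⟨hr.1.le, hr.2.le⟩) (hy0 ▸ hw0) hr
  refine ⟨?_, ?_, fun r hr => ?_, ?_⟩
  · rw [show v = fun r => w r / y r from funext hv]
    exact hwc.div hyc fun r hr => (hyneg r hr).ne
  · rw [hv, hy0, div_self hw0.ne]
  · have hr0 := hr.1.ne'
    have hMr := (hMpos r hr.1 hr.2.le).ne'
    have hyr := (hyneg r ⟨hr.1.le, hr.2.le⟩).ne
    have hε : ε r = -(y r * r ^ 3 / M r) := by
      rw [hyε r hr]
      field_simp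
    rw [show v = fun r => w r / y r from funext hv]
    refine ((hw' r hr).div (hy' r hr) hyr).congr_deriv ?_
    rw [rhoBar, if_neg hr0, hε]
    change _ = _ + 3 / 5 * deriv ρ r / (3 / r ^ 3 * M r)
    field_simp
    ring
  · have hyR := (hyneg R (right_mem_Icc.mpr hR.le)).ne
    have hm : 0 < massOf ρ R := mul_pos (by positivity) (hMpos R hR le_rfl)
    have hI : 0 < inertiaOf ρ R :=
      mul_pos (by positivity) (integral_pow_mul_pos 4 hρc hpos hR le_rfl)
    have hRI : 0 < RIof ρ R := Real.sqrt_pos.mpr (by positivity)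
    have hRI2 : RIof ρ R ^ 2 = 5 * inertiaOf ρ R / (2 * massOf ρ R) :=
      Real.sq_sqrt (by positivity)
    have h1v : 1 - v R = A R / (5 * R ^ 5 * y R) := by
      rw [hv, one_sub_div hyR]
      nth_rewrite 1 [hyw R]
      field_simp
      ring
    have hRI5 : (RIof ρ R / R) ^ 5 =
        RIof ρ R ^ 3 * (5 * inertiaOf ρ R / (2 * massOf ρ R)) / R ^ 5 := by
      rw [← hRI2]; ring
    rw [h1v, hRI5, hv, hwR, gammaOf, hAε, gammaIof, hk]
    rcases eq_or_ne (A R) 0 with hA0 | hA0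
    · simp [hA0]
    · field_simp
      ring
end

section
/- Assume ρ : [0,∞) → ℝ is C², non-increasing, with ρ(r) > 0 for 0 ≤ r < R and ρ(r) = 0 for r ≥ R. Let v : [0,R] → ℝ be the function arising from the bounded Clairaut solution (equivalently, the continuous solution of the Riccati initial value problem v′(r) = (5/r)·v(r)(1 − v(r)) + (3/5)·ρ′(r)/ρ̄(r) on (0,R] with v(0) = 1). Then 0 < v(r) ≤ 1 for all r ∈ [0,R]. -/
open MeasureTheory Set Real

/-- The derivative of the mass-type integral `∫₀^r a²ρ(a) da`. -/
lemma hasDerivAt_massIntegral {ρ : ℝ → ℝ} (hρ : Continuous ρ) (r : ℝ) :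
    HasDerivAt (fun r => ∫ a in (0:ℝ)..r, a ^ 2 * ρ a) (r ^ 2 * ρ r) r := by
  have hc : Continuous fun a : ℝ => a ^ 2 * ρ a := by fun_prop
  exact intervalIntegral.integral_hasDerivAt_right (hc.intervalIntegrable _ _)
    (hc.stronglyMeasurableAtFilter _ _) hc.continuousAt

/-- For a non-increasing density, the density is at most the mean density. -/
lemma mul_cube_le_massIntegral {ρ : ℝ → ℝ} (hρ : Continuous ρ) (hmono : AntitoneOn ρ (Ici 0))
    {r : ℝ} (hr : 0 ≤ r) :
    ρ r * r ^ 3 ≤ 3 * ∫ a in (0:ℝ)..r, a ^ 2 * ρ a := by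
  have hc : Continuous fun a : ℝ => a ^ 2 * ρ a := by fun_prop
  have hc' : Continuous fun a : ℝ => a ^ 2 * ρ r := by fun_prop
  have h := intervalIntegral.integral_mono_on hr (hc'.intervalIntegrable 0 r)
    (hc.intervalIntegrable 0 r) (μ := volume) fun a ha =>
      mul_le_mul_of_nonneg_left (hmono ha.1 hr ha.2) (sq_nonneg a)
  rw [intervalIntegral.integral_mul_const, integral_pow] at h
  norm_num at h
  linarith

/-- A continuous function on `[0,b]` satisfies any strict inequality valid at `0` also at some
positive point below `b`. -/
lemma exists_pos_lt_of_continuousOn {v : ℝ → ℝ} {R b : ℝ} (hv : ContinuousOn v (Icc 0 R))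
    (hb : 0 < b) (hbR : b ≤ R) {U : Set ℝ} (hU : U ∈ nhds (v 0)) :
    ∃ δ, 0 < δ ∧ δ < b ∧ v δ ∈ U := by
  have h0 : Filter.Tendsto v (nhdsWithin 0 (Ioo 0 b)) (nhds (v 0)) :=
    (hv 0 ⟨le_rfl, hb.le.trans hbR⟩).mono_left
      (nhdsWithin_mono _ fun x hx => ⟨hx.1.le, hx.2.le.trans hbR⟩)
  have : (nhdsWithin (0:ℝ) (Ioo 0 b)).NeBot := left_nhdsWithin_Ioo_neBot hb
  obtain ⟨δ, hδU, hδ⟩ := ((h0.eventually hU).and self_mem_nhdsWithin).exists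
  exact ⟨δ, hδ.1, hδ.2, hδU⟩

/-- For a `C²` non-increasing density, positive on `[0,R)` and zero on
`[R,∞)`, the continuous solution `v` of the Riccati initial value problem
`v′(r) = (5/r)v(1−v) + (3/5)ρ′/ρ̄` on `(0,R]` with `v(0) = 1` satisfies
`0 < v(r) ≤ 1` on `[0,R]`. -/
theorem stmt_8 (R : ℝ) (hR : 0 < R)
    (ρ : ℝ → ℝ) (hC2 : ContDiff ℝ 2 ρ) (hmono : AntitoneOn ρ (Ici 0))
    (hpos : ∀ r : ℝ, 0 ≤ r → r < R → 0 < ρ r) (hzero : ∀ r : ℝ, R ≤ r → ρ r = 0)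
    (v : ℝ → ℝ) (hvcont : ContinuousOn v (Icc 0 R)) (hv0 : v 0 = 1)
    (hvderiv : ∀ r ∈ Ioc (0:ℝ) R,
      HasDerivAt v ((5 / r) * v r * (1 - v r) + (3 / 5) * deriv ρ r / rhoBar ρ r) r) :
    ∀ r ∈ Icc (0:ℝ) R, 0 < v r ∧ v r ≤ 1 := by
  have hρc : Continuous ρ := hC2.continuous
  have hρd : ∀ r, HasDerivAt ρ (deriv ρ r) r := fun r =>
    (hC2.differentiable (by norm_num) r).hasDerivAt
  have hρ' : ∀ r, 0 < r → deriv ρ r ≤ 0 := fun r hr => by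
    rw [← derivWithin_of_mem_nhds (Ici_mem_nhds hr)]
    exact hmono.derivWithin_nonpos
  have hρ0 : ∀ r, 0 ≤ r → 0 ≤ ρ r := fun r hr => by
    rcases lt_or_ge r R with h | h
    · exact (hpos r hr h).le
    · exact (hzero r h).ge
  set M : ℝ → ℝ := fun r => ∫ a in (0:ℝ)..r, a ^ 2 * ρ a with hM
  have hMd : ∀ r, HasDerivAt M (r ^ 2 * ρ r) r := hasDerivAt_massIntegral hρc
  have hMpos : ∀ r ∈ Ioc (0:ℝ) R, 0 < M r := fun r hr => by
    have hc : Continuous fun a : ℝ => a ^ 2 * ρ a := by fun_prop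
    exact intervalIntegral.intervalIntegral_pos_of_pos_on (hc.intervalIntegrable _ _)
      (fun a ha => mul_pos (pow_pos ha.1 2) (hpos a ha.1.le (ha.2.trans_le hr.2))) hr.1
  have hbar : ∀ r ∈ Ioc (0:ℝ) R, rhoBar ρ r = 3 / r ^ 3 * M r := fun r hr => by
    simp [rhoBar, hr.1.ne', hM]
  intro r hr
  rcases hr.1.eq_or_lt with rfl | hr0
  · simp [hv0]
  constructor
  · obtain ⟨δ, hδ, hδr, hvδ⟩ := exists_pos_lt_of_continuousOn hvcont hr0 hr.2
      (Ioi_mem_nhds (show (4 / 5 : ℝ) < v 0 by rw [hv0]; norm_num))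
    have hsub : ∀ x ∈ Icc δ r, x ∈ Ioc (0:ℝ) R := fun x hx =>
      ⟨hδ.trans_le hx.1, hx.2.trans hr.2⟩
    have hfd : ∀ x ∈ Icc δ r, HasDerivAt (fun x => ρ x * x ^ 3 / (5 * M x) - v x)
        (3 * x ^ 2 * ρ x / (5 * M x) - ρ x ^ 2 * x ^ 5 / (5 * M x ^ 2)
          - 5 / x * v x * (1 - v x)) x := fun x hx => by
      have hx' := hsub x hx
      have hMx := (hMpos x hx').ne'
      have hx0 := hx'.1.ne'
      have h := (((hρd x).mul (hasDerivAt_pow 3 x)).div ((hMd x).const_mul 5)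
        (mul_ne_zero (by norm_num) hMx)).sub (hvderiv x hx')
      rw [hbar x hx'] at h
      refine h.congr_deriv ?_
      simp only [Pi.mul_apply]
      field_simp
      ring
    have key := image_le_of_deriv_right_lt_deriv_boundary
      (f := fun x => ρ x * x ^ 3 / (5 * M x) - v x) (B := fun _ => -(1 / 5 : ℝ)) (B' := fun _ => 0)
      (fun x hx => (hfd x hx).continuousAt.continuousWithinAt)
      (fun x hx => (hfd x ⟨hx.1, hx.2.le⟩).hasDerivWithinAt)
      ?_ (fun x => hasDerivAt_const x _) ?_ (right_mem_Icc.2 hδr.le)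
    · have h : 0 ≤ ρ r * r ^ 3 / (5 * M r) :=
        div_nonneg (mul_nonneg (hρ0 r hr.1) (pow_nonneg hr.1 3))
          (mul_nonneg (by norm_num) (hMpos r ⟨hr0, hr.2⟩).le)
      linarith
    · have hMδ := hMpos δ (hsub δ (left_mem_Icc.2 hδr.le))
      have h : ρ δ * δ ^ 3 / (5 * M δ) ≤ 3 / 5 := by
        rw [div_le_iff₀ (by positivity)]
        have : ρ δ * δ ^ 3 ≤ 3 * M δ := mul_cube_le_massIntegral hρc hmono hδ.le
        linarith
      have hvδ' : 4 / 5 < v δ := hvδ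
      linarith
    · intro x hx hxv
      have hx' := hsub x ⟨hx.1, hx.2.le⟩
      have hMx := (hMpos x hx').ne'
      have hx0 := hx'.1.ne'
      have hv : v x = ρ x * x ^ 3 / (5 * M x) + 1 / 5 := by linarith
      have : 3 * x ^ 2 * ρ x / (5 * M x) - ρ x ^ 2 * x ^ 5 / (5 * M x ^ 2)
          - 5 / x * v x * (1 - v x) = -(4 / 5) / x := by
        rw [hv]
        field_simp
        ring
      rw [this]
      exact div_neg_of_neg_of_pos (by norm_num) hx'.1
  · refine le_of_forall_gt_imp_ge_of_dense fun t ht => ?_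
    obtain ⟨δ, hδ, hδr, hvδ⟩ := exists_pos_lt_of_continuousOn hvcont hr0 hr.2
      (Iio_mem_nhds (show v 0 < t by rwa [hv0]))
    have hsub : ∀ x ∈ Icc δ r, x ∈ Ioc (0:ℝ) R := fun x hx =>
      ⟨hδ.trans_le hx.1, hx.2.trans hr.2⟩
    refine image_le_of_deriv_right_lt_deriv_boundary (B := fun _ => t) (B' := fun _ => 0)
      (fun x hx => (hvderiv x (hsub x hx)).continuousAt.continuousWithinAt)
      (fun x hx => (hvderiv x (hsub x ⟨hx.1, hx.2.le⟩)).hasDerivWithinAt)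
      (le_of_lt hvδ) (fun x => hasDerivAt_const x _) ?_ (right_mem_Icc.2 hδr.le)
    intro x hx hxv
    have hx' := hsub x ⟨hx.1, hx.2.le⟩
    have hbpos : 0 < rhoBar ρ x := by
      rw [hbar x hx']
      exact mul_pos (div_pos (by norm_num) (pow_pos hx'.1 3)) (hMpos x hx')
    have h1 : 3 / 5 * deriv ρ x / rhoBar ρ x ≤ 0 :=
      div_nonpos_of_nonpos_of_nonneg (by linarith [hρ' x hx'.1]) hbpos.le
    have h2 : 5 / x * v x * (1 - v x) < 0 := by
      rw [hxv]
      exact mul_neg_of_pos_of_neg (mul_pos (div_pos (by norm_num) hx'.1) (by linarith))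
        (by linarith)
    linarith
end

section
/- Assume ρ : [0,∞) → ℝ is C², non-increasing, with ρ(0) > 0. Let v : [0,R] → ℝ be continuous, continuously differentiable on (0,R], with v(0) = 1 and v′(r) = (5/r)·v(r)(1 − v(r)) + (3/5)·ρ′(r)/ρ̄(r) for 0 < r ≤ R. Define H(r) = 5·ρ̄(r)·v(r) − 3·ρ(r) − 2·ρ̄(r). Then H(r) ≥ 0 for all 0 ≤ r ≤ R. -/
open MeasureTheory Set Real

theorem hasDerivAt_rhoBar {ρ : ℝ → ℝ} (hρ : Continuous ρ) {r : ℝ} (hr : 0 < r) :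
    HasDerivAt (rhoBar ρ) (3 / r * (ρ r - rhoBar ρ r)) r := by
  have hcont : Continuous fun a : ℝ => a ^ 2 * ρ a := by fun_prop
  have hint : HasDerivAt (fun s : ℝ => ∫ a in (0:ℝ)..s, a ^ 2 * ρ a) (r ^ 2 * ρ r) r :=
    intervalIntegral.integral_hasDerivAt_right (hcont.intervalIntegrable _ _)
      (hcont.stronglyMeasurableAtFilter _ _) hcont.continuousAt
  have hcoef : HasDerivAt (fun s : ℝ => 3 / s ^ 3) (-(9 / r ^ 4)) r := by
    have h := (hasDerivAt_const r (3:ℝ)).div (hasDerivAt_pow 3 r) (by positivity)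
    refine h.congr_deriv ?_
    field_simp
    norm_num
    ring
  have heq : rhoBar ρ =ᶠ[nhds r] fun s => 3 / s ^ 3 * ∫ a in (0:ℝ)..s, a ^ 2 * ρ a := by
    filter_upwards [lt_mem_nhds hr] with s hs
    simp [rhoBar, hs.ne']
  refine ((hcoef.mul hint).congr_of_eventuallyEq heq).congr_deriv ?_
  rw [heq.eq_of_nhds]
  field_simp
  ring

theorem rhoBar_mem_Icc {ρ : ℝ → ℝ} (hρ : Continuous ρ) (hmono : AntitoneOn ρ (Ici 0))
    {r : ℝ} (hr : 0 ≤ r) : rhoBar ρ r ∈ Icc (ρ r) (ρ 0) := by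
  rcases hr.eq_or_lt with rfl | hr'
  · simp [rhoBar]
  have hint (f : ℝ → ℝ) (hf : Continuous f) :
      IntervalIntegrable (fun a => a ^ 2 * f a) volume 0 r :=
    (by fun_prop : Continuous fun a : ℝ => a ^ 2 * f a).intervalIntegrable _ _
  have hconst (c : ℝ) : 3 / r ^ 3 * ∫ a in (0:ℝ)..r, a ^ 2 * c = c := by
    rw [intervalIntegral.integral_mul_const, integral_pow]
    norm_num
    field_simp
  have hcoef : 0 ≤ 3 / r ^ 3 := by positivity
  rw [rhoBar, if_neg hr'.ne']
  constructor
  · nth_rewrite 1 [← hconst (ρ r)]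
    refine mul_le_mul_of_nonneg_left ?_ hcoef
    refine intervalIntegral.integral_mono_on hr (hint _ continuous_const) (hint _ hρ) ?_
    intro a ha
    exact mul_le_mul_of_nonneg_left (hmono ha.1 hr ha.2) (sq_nonneg a)
  · rw [← hconst (ρ 0)]
    refine mul_le_mul_of_nonneg_left ?_ hcoef
    refine intervalIntegral.integral_mono_on hr (hint _ hρ) (hint _ continuous_const) ?_
    intro a ha
    exact mul_le_mul_of_nonneg_left (hmono self_mem_Ici ha.1 ha.1) (sq_nonneg a)

theorem continuousOn_rhoBar {ρ : ℝ → ℝ} (hρ : Continuous ρ) (hmono : AntitoneOn ρ (Ici 0)) :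
    ContinuousOn (rhoBar ρ) (Ici 0) := by
  intro r hr
  rcases (mem_Ici.mp hr).eq_or_lt with rfl | hr'
  · have h0 : rhoBar ρ 0 = ρ 0 := by simp [rhoBar]
    rw [ContinuousWithinAt, h0]
    refine tendsto_of_tendsto_of_tendsto_of_le_of_le' (hρ.continuousWithinAt (s := Ici 0))
      tendsto_const_nhds ?_ ?_ <;> filter_upwards [self_mem_nhdsWithin] with s hs
    · exact (rhoBar_mem_Icc hρ hmono hs).1
    · exact (rhoBar_mem_Icc hρ hmono hs).2
  · exact (hasDerivAt_rhoBar hρ hr').continuousAt.continuousWithinAt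

/-- A continuous function that starts nonnegative and cannot decrease while it is negative stays
nonnegative. -/
theorem nonneg_of_deriv_nonneg_of_neg {W W' : ℝ → ℝ} {R : ℝ} (hW : ContinuousOn W (Icc 0 R))
    (h0 : 0 ≤ W 0) (hderiv : ∀ r ∈ Ioc 0 R, HasDerivAt W (W' r) r)
    (hneg : ∀ r ∈ Ioc 0 R, W r < 0 → 0 ≤ W' r) : ∀ r ∈ Icc 0 R, 0 ≤ W r := by
  intro r hr
  by_contra! hlt
  have hsub : Icc 0 r ⊆ Icc 0 R := Icc_subset_Icc_right hr.2
  have hcomp : IsCompact (Icc 0 r ∩ W ⁻¹' Ici 0) :=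
    isCompact_Icc.of_isClosed_subset
      ((hW.mono hsub).preimage_isClosed_of_isClosed isClosed_Icc isClosed_Ici) inter_subset_left
  obtain ⟨s, ⟨hs, hWs⟩, hmax⟩ := hcomp.exists_isGreatest ⟨0, ⟨le_rfl, hr.1⟩, h0⟩
  have hWs' : 0 ≤ W s := hWs
  have hIoo : ∀ t ∈ Ioo s r, t ∈ Ioc 0 R ∧ W t < 0 := by
    intro t ht
    refine ⟨⟨hs.1.trans_lt ht.1, ht.2.le.trans hr.2⟩, ?_⟩
    by_contra! hle
    exact ht.1.not_ge (hmax ⟨⟨hs.1.trans ht.1.le, ht.2.le⟩, hle⟩)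
  have hmono : MonotoneOn W (Icc s r) := by
    refine monotoneOn_of_deriv_nonneg (convex_Icc s r)
      (hW.mono (Icc_subset_Icc hs.1 hr.2)) ?_ ?_ <;> rw [interior_Icc] <;> intro t ht
    · exact (hderiv t (hIoo t ht).1).differentiableAt.differentiableWithinAt
    · rw [(hderiv t (hIoo t ht).1).deriv]
      exact hneg t (hIoo t ht).1 (hIoo t ht).2
  have := hmono (left_mem_Icc.mpr hs.2) (right_mem_Icc.mpr hs.2) hs.2
  linarith

theorem exists_nonneg_add_five_mul_div {v : ℝ → ℝ} {R : ℝ} (hv : ContinuousOn v (Icc 0 R))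
    (hR : 0 < R) (hv0 : 0 < v 0) : ∃ K, ∀ r ∈ Ioc 0 R, 0 ≤ K + 5 * v r / r := by
  have hnear : ∀ᶠ r in nhdsWithin 0 (Icc 0 R), 0 < v r :=
    (hv 0 (left_mem_Icc.mpr hR.le)).eventually (lt_mem_nhds hv0)
  obtain ⟨ε, hε, hpos⟩ := Metric.mem_nhdsWithin_iff.mp hnear
  obtain ⟨M, hM⟩ := isCompact_Icc.exists_bound_of_continuousOn hv
  have hM0 : 0 ≤ M := (norm_nonneg _).trans (hM 0 (left_mem_Icc.mpr hR.le))
  refine ⟨5 * M / ε, fun r hr => ?_⟩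
  have hK : 0 ≤ 5 * M / ε := by positivity
  have hr0 : 0 < r := hr.1
  rcases lt_or_ge r ε with hlt | hge
  · have hvr : 0 < v r := hpos ⟨by simpa [abs_of_pos hr0] using hlt, hr0.le, hr.2⟩
    positivity
  · have hvr : -M ≤ v r := (abs_le.mp (hM r ⟨hr0.le, hr.2⟩)).1
    have h1 : 5 * M / r ≤ 5 * M / ε := by gcongr
    have h2 : -(5 * M / r) ≤ 5 * v r / r := by
      rw [← neg_div]
      gcongr
      linarith
    linarith

/-- For a `C²` non-increasing density with `ρ(0) > 0` and `v` the
continuous solution of the Riccati equation `v′ = (5/r)v(1−v) + (3/5)ρ′/ρ̄` on `(0,R]`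
with `v(0) = 1`, the function `H = 5ρ̄v − 3ρ − 2ρ̄` is non-negative on `[0,R]`. -/
theorem stmt_9 (R : ℝ) (hR : 0 < R)
    (ρ : ℝ → ℝ) (hC2 : ContDiff ℝ 2 ρ) (hmono : AntitoneOn ρ (Ici 0))
    (hρ0 : 0 < ρ 0)
    (v : ℝ → ℝ) (hvcont : ContinuousOn v (Icc 0 R)) (hv0 : v 0 = 1)
    (hvderiv : ∀ r ∈ Ioc (0:ℝ) R,
      HasDerivAt v ((5 / r) * v r * (1 - v r) + (3 / 5) * deriv ρ r / rhoBar ρ r) r)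
    (H : ℝ → ℝ)
    (hH : ∀ r : ℝ, H r = 5 * rhoBar ρ r * v r - 3 * ρ r - 2 * rhoBar ρ r) :
    ∀ r ∈ Icc (0:ℝ) R, 0 ≤ H r := by
  have hρ : Continuous ρ := hC2.continuous
  have hρ' (r : ℝ) : HasDerivAt ρ (deriv ρ r) r :=
    (hC2.differentiable (by norm_num) r).hasDerivAt
  have hderiv_nonpos : ∀ r : ℝ, 0 < r → deriv ρ r ≤ 0 := by
    intro r hr
    rw [← derivWithin_of_mem_nhds (Ici_mem_nhds hr)]
    exact hmono.derivWithin_nonpos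
  have hbarcont : ContinuousOn (rhoBar ρ) (Icc 0 R) :=
    (continuousOn_rhoBar hρ hmono).mono Icc_subset_Ici_self
  obtain ⟨K, hK⟩ := exists_nonneg_add_five_mul_div hvcont hR (by rw [hv0]; exact one_pos)
  have hHcont : ContinuousOn H (Icc 0 R) := by
    rw [funext hH]
    have := hρ.continuousOn (s := Icc 0 R)
    fun_prop
  have hHderiv : ∀ r ∈ Ioc 0 R,
      ∃ d, HasDerivAt H d r ∧ -(5 * v r / r) * H r ≤ d := by
    intro r hr
    have hr0 : 0 < r := hr.1
    have hbar := hasDerivAt_rhoBar hρ hr0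
    rw [funext hH]
    refine ⟨_, (((hbar.const_mul 5).mul (hvderiv r hr)).sub ((hρ' r).const_mul 3)).sub
      (hbar.const_mul 2), ?_⟩
    have hle : 0 ≤ 6 / r * (rhoBar ρ r - ρ r) :=
      mul_nonneg (by positivity) (sub_nonneg.mpr (rhoBar_mem_Icc hρ hmono hr0.le).1)
    -- Where the mean density vanishes, division by zero makes this an inequality.
    have hquot : deriv ρ r ≤ rhoBar ρ r * (deriv ρ r / rhoBar ρ r) := by
      rcases eq_or_ne (rhoBar ρ r) 0 with h | h
      · simpa [h] using hderiv_nonpos r hr0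
      · rw [mul_div_cancel₀ _ h]
    have hsplit : (3 / 5) * deriv ρ r / rhoBar ρ r = (3 / 5) * (deriv ρ r / rhoBar ρ r) := by
      ring
    rw [hsplit]
    generalize deriv ρ r / rhoBar ρ r = q at hquot ⊢
    linear_combination hle + 3 * hquot
  choose! d hd hdle using hHderiv
  have hexp (r : ℝ) : HasDerivAt (fun s => exp (-K * s)) (exp (-K * r) * -K) r := by
    simpa using ((hasDerivAt_id r).const_mul (-K)).exp
  have hW := nonneg_of_deriv_nonneg_of_neg (W := fun r => exp (-K * r) * H r)
    (by fun_prop) (by simp [hH, hv0, rhoBar]; linarith)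
    (fun r hr => (hexp r).mul (hd r hr)) (by
      intro r hr hneg
      have hHneg : H r < 0 := by
        by_contra! h
        exact hneg.not_ge (mul_nonneg (exp_pos _).le h)
      have hsum : 0 ≤ d r - K * H r := by
        linear_combination hdle r hr + mul_nonneg (hK r hr) (neg_nonneg.mpr hHneg.le)
      linear_combination mul_nonneg (exp_pos (-K * r)).le hsum)
  exact fun r hr => nonneg_of_mul_nonneg_right (hW r hr) (exp_pos _)
end

section
/- Assume ρ : [0,∞) → ℝ is C², non-increasing, with ρ(r) > 0 for 0 ≤ r < R and ρ(r) = 0 for r ≥ R. Let ε be the unique bounded solution of Clairaut's integral equation for some Ω > 0 and set γ = −15·I₀·Ω²/(8π·∫₀^R a⁵ε(a)ρ′(a) da). Then γ/γ_I ≤ √(35/39)·(8575/8112), a number approximately equal to 1.001401; this bound holds for every value of R_I/R in (0,1]. -/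
open MeasureTheory Set Real

open Filter Topology

/-- A monotone function on `(0, ∞)` that tends to `0` at `0⁺` is nonnegative. -/
lemma nonneg_of_monotoneOn_of_tendsto_zero {f : ℝ → ℝ} {b : ℝ} (hf : MonotoneOn f (Ioc 0 b))
    (h0 : Tendsto f (𝓝[>] 0) (𝓝 0)) {r : ℝ} (hr : r ∈ Ioc 0 b) : 0 ≤ f r := by
  refine le_of_tendsto h0 ?_
  filter_upwards [Ioo_mem_nhdsGT hr.1] with s hs
  exact hf ⟨hs.1, hs.2.le.trans hr.2⟩ hr hs.2.le

lemma monotoneOn_Ioc_of_hasDerivAt_nonneg {f f' : ℝ → ℝ} {b : ℝ}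
    (hf : ∀ r, 0 < r → HasDerivAt f (f' r) r) (h : ∀ r, 0 < r → r < b → 0 ≤ f' r) :
    MonotoneOn f (Ioc 0 b) := by
  refine monotoneOn_of_deriv_nonneg (convex_Ioc 0 b)
    (fun r hr => (hf r hr.1).continuousAt.continuousWithinAt)
    (fun r hr => ?_) (fun r hr => ?_) <;> rw [interior_Ioc] at hr
  · exact (hf r hr.1).differentiableAt.differentiableWithinAt
  · rw [(hf r hr.1).deriv]; exact h r hr.1 hr.2

lemma antitoneOn_Icc_of_hasDerivAt_nonpos {f f' : ℝ → ℝ} {a b : ℝ} (ha : 0 < a)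
    (hf : ∀ r, 0 < r → r ≤ b → HasDerivAt f (f' r) r) (h : ∀ r, a < r → r < b → f' r ≤ 0) :
    AntitoneOn f (Icc a b) := by
  refine antitoneOn_of_deriv_nonpos (convex_Icc a b)
    (fun r hr => (hf r (ha.trans_le hr.1) hr.2).continuousAt.continuousWithinAt)
    (fun r hr => ?_) (fun r hr => ?_) <;> rw [interior_Icc] at hr
  · exact (hf r (ha.trans hr.1) hr.2.le).differentiableAt.differentiableWithinAt
  · rw [(hf r (ha.trans hr.1) hr.2.le).deriv]; exact h r hr.1 hr.2

/-- A level that a function can only exceed while decreasing is never crossed upwards. -/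
lemma le_of_hasDerivAt_nonpos_above {f f' : ℝ → ℝ} {a b B : ℝ} (ha : 0 < a) (hab : a ≤ b)
    (hf : ∀ r, 0 < r → r ≤ b → HasDerivAt f (f' r) r) (hfa : f a ≤ B)
    (h : ∀ r, a < r → r < b → B < f r → f' r ≤ 0) : f b ≤ B := by
  have hcont : ContinuousOn f (Icc a b) := fun r hr =>
    (hf r (ha.trans_le hr.1) hr.2).continuousAt.continuousWithinAt
  have hclosed : IsClosed (Icc a b ∩ f ⁻¹' Iic B) :=
    hcont.preimage_isClosed_of_isClosed isClosed_Icc isClosed_Iic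
  have hcomp : IsCompact (Icc a b ∩ f ⁻¹' Iic B) :=
    isCompact_Icc.of_isClosed_subset hclosed inter_subset_left
  obtain ⟨s, ⟨hs, hsB⟩, hmax⟩ := hcomp.exists_isGreatest ⟨a, ⟨le_rfl, hab⟩, hfa⟩
  have hanti := antitoneOn_Icc_of_hasDerivAt_nonpos (a := s) (ha.trans_le hs.1) hf
    fun r h1 h2 => h r (hs.1.trans_lt h1) h2 (by
      by_contra! hle
      exact absurd (hmax ⟨⟨hs.1.trans h1.le, h2.le⟩, hle⟩) (not_le.2 h1))
  exact (hanti ⟨le_rfl, hs.2⟩ ⟨hs.2, le_rfl⟩ hs.2).trans hsB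

/-- The density `ρ`, the moments `M` and `N`, and the flattening `ε` with slope `e`, together
with the quantities `V`, `r⁵P` into which `ε r² M` splits: the first order system to which
Clairaut's integral equation is equivalent. -/
structure ClairautSystem (R : ℝ) (ρ M N ε e P V : ℝ → ℝ) : Prop where
  hasDerivAt_M : ∀ r, 0 < r → HasDerivAt M (r ^ 2 * ρ r) r
  hasDerivAt_N : ∀ r, 0 < r → HasDerivAt N (r ^ 4 * ρ r) r
  hasDerivAt_eps : ∀ r, 0 < r → HasDerivAt ε (e r) r
  hasDerivAt_P : ∀ r, 0 < r → HasDerivAt P (-(e r * ρ r) / 5) r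
  hasDerivAt_V : ∀ r, 0 < r → HasDerivAt V ((5 * r ^ 4 * ε r + r ^ 5 * e r) * ρ r / 5) r
  M_pos : ∀ r, 0 < r → 0 < M r
  N_pos : ∀ r, 0 < r → 0 < N r
  rho_nonneg : ∀ r, 0 < r → 0 ≤ ρ r
  rho_pos : ∀ r, 0 < r → r < R → 0 < ρ r
  rho_le : ∀ r, 0 < r → r ^ 3 * ρ r ≤ 3 * M r
  N_le : ∀ r, 0 < r → 5 * N r ≤ 3 * r ^ 2 * M r
  split : ∀ r, 0 < r → ε r * r ^ 2 * M r = V r + r ^ 5 * P r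
  slope : ∀ r, 0 < r → r ^ 3 * M r * e r = 3 * (r ^ 5 * P r) - 2 * V r
  bounded : ∃ C, ∀ r, 0 < r → |ε r| ≤ C ∧ |P r| ≤ C
  tendsto_V : Tendsto V (𝓝[>] 0) (𝓝 0)
  tendsto_ratio : Tendsto (fun r => 1 - r ^ 3 * ρ r / (3 * M r)) (𝓝[>] 0) (𝓝 0)
  P_end : 0 < P R
  V_end : 0 < V R

namespace ClairautSystem

variable {R : ℝ} {ρ M N ε e P V : ℝ → ℝ}

lemma hasDerivAt_slope (h : ClairautSystem R ρ M N ε e P V) (r : ℝ) (hr : 0 < r) :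
    HasDerivAt (fun r => 3 * (r ^ 5 * P r) - 2 * V r)
      (15 * r ^ 4 * P r * (1 - r ^ 3 * ρ r / (3 * M r))) r := by
  have h1 := ((((hasDerivAt_pow 5 r).mul (h.hasDerivAt_P r hr)).const_mul 3).sub
    ((h.hasDerivAt_V r hr).const_mul 2))
  refine h1.congr_deriv ?_
  have hM := h.M_pos r hr
  have hs := h.split r hr
  have he := h.slope r hr
  have : r ^ 3 * M r *
      (r ^ 5 * e r * ρ r + 2 * r ^ 4 * ε r * ρ r - 5 * r ^ 7 * P r * ρ r / M r) = 0 := by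
    field_simp
    linear_combination r ^ 5 * ρ r * he + 2 * r ^ 5 * ρ r * hs
  have h2 := (mul_eq_zero.1 this).resolve_left (by positivity)
  simp only [Nat.cast_ofNat, Nat.reduceSub]
  have h3 : 15 * r ^ 4 * P r * (1 - r ^ 3 * ρ r / (3 * M r)) =
    15 * r ^ 4 * P r - 5 * r ^ 7 * P r * ρ r / M r := by field_simp; ring
  rw [h3]
  linear_combination -h2

lemma one_sub_ratio_mem (h : ClairautSystem R ρ M N ε e P V) {r : ℝ} (hr : 0 < r) :
    1 - r ^ 3 * ρ r / (3 * M r) ∈ Icc (0 : ℝ) 1 := by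
  have hM := h.M_pos r hr
  have hρ := h.rho_nonneg r hr
  have h1 : r ^ 3 * ρ r / (3 * M r) ≤ 1 := by
    rw [div_le_one (by positivity)]; exact h.rho_le r hr
  have h2 : 0 ≤ r ^ 3 * ρ r / (3 * M r) := by positivity
  exact ⟨by linarith, by linarith⟩

lemma tendsto_slope (h : ClairautSystem R ρ M N ε e P V) :
    Tendsto (fun r => 3 * (r ^ 5 * P r) - 2 * V r) (𝓝[>] 0) (𝓝 0) := by
  obtain ⟨C, hC⟩ := h.bounded
  have h5 : Tendsto (fun r : ℝ => r ^ 5) (𝓝[>] 0) (𝓝 0) := by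
    have : Tendsto (fun r : ℝ => r ^ 5) (𝓝 0) (𝓝 (0 ^ 5)) := (continuous_pow 5).tendsto 0
    rw [zero_pow (by norm_num)] at this
    exact this.mono_left nhdsWithin_le_nhds
  have hb : IsBoundedUnder (· ≤ ·) (𝓝[>] 0) ((‖·‖) ∘ P) :=
    isBoundedUnder_of_eventually_le (a := C) (by
      filter_upwards [self_mem_nhdsWithin] with r hr using (hC r hr).2)
  have := ((h5.zero_mul_isBoundedUnder_le hb).const_mul 3).sub (h.tendsto_V.const_mul 2)
  simpa using this

/-- The product of the flattening and its (weighted) slope is nondecreasing, hence nonnegative. -/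
lemma eps_mul_slope_nonneg (h : ClairautSystem R ρ M N ε e P V) {r : ℝ} (hr : 0 < r) :
    0 ≤ ε r * (3 * (r ^ 5 * P r) - 2 * V r) := by
  have hmono := monotoneOn_Ioc_of_hasDerivAt_nonneg (b := r)
    (fun s hs => (h.hasDerivAt_eps s hs).mul (h.hasDerivAt_slope s hs)) (by
      intro s hs _
      have hM := h.M_pos s hs
      obtain ⟨hg0, hg1⟩ := h.one_sub_ratio_mem hs
      have hsp := h.split s hs
      have hsl := h.slope s hs
      set g := 1 - s ^ 3 * ρ s / (3 * M s)
      set E := 3 * (s ^ 5 * P s) - 2 * V s with hE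
      set X := ε s * s ^ 2 * M s with hX
      have h5 : 5 * (s ^ 5 * P s) = 2 * X + E := by rw [hsp, hE]; ring
      have key : s ^ 3 * M s * (e s * E + ε s * (15 * s ^ 4 * P s * g)) =
          E ^ 2 + 3 * g * X * (2 * X + E) := by
        rw [← h5, hX]; linear_combination E * hsl
      have hq : 0 ≤ E ^ 2 + 3 * g * X * (2 * X + E) := by
        nlinarith [sq_nonneg (E + 3 / 2 * g * X), mul_nonneg hg0 (sq_nonneg X),
          mul_nonneg (mul_nonneg hg0 (sub_nonneg.2 hg1)) (sq_nonneg X)]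
      exact nonneg_of_mul_nonneg_right (key ▸ hq) (by positivity))
  obtain ⟨C, hC⟩ := h.bounded
  have hb : IsBoundedUnder (· ≤ ·) (𝓝[>] 0) ((‖·‖) ∘ ε) :=
    isBoundedUnder_of_eventually_le (a := C) (by
      filter_upwards [self_mem_nhdsWithin] with r hr using (hC r hr).1)
  have ht := isBoundedUnder_le_mul_tendsto_zero hb h.tendsto_slope
  exact nonneg_of_monotoneOn_of_tendsto_zero hmono ht (r := r) ⟨hr, le_rfl⟩

lemma sq_eps_monotoneOn (h : ClairautSystem R ρ M N ε e P V) :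
    MonotoneOn (fun r => ε r ^ 2) (Ioc 0 R) := by
  refine monotoneOn_Ioc_of_hasDerivAt_nonneg
    (fun r hr => (h.hasDerivAt_eps r hr).pow 2) (fun r hr _ => ?_)
  have hM := h.M_pos r hr
  have h1 := h.eps_mul_slope_nonneg hr
  rw [← h.slope r hr] at h1
  have h2 : 0 ≤ r ^ 3 * M r * (ε r * e r) := by linarith
  have h3 := nonneg_of_mul_nonneg_right h2 (by positivity)
  simp only [Nat.cast_ofNat, Nat.add_one_sub_one, pow_one]
  linarith

lemma slope_nonneg_of_eps_pos (h : ClairautSystem R ρ M N ε e P V) {r : ℝ} (hr : 0 < r)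
    (hε : 0 < ε r) : 0 ≤ 3 * (r ^ 5 * P r) - 2 * V r ∧ 0 ≤ e r := by
  have h1 := nonneg_of_mul_nonneg_right (h.eps_mul_slope_nonneg hr) hε
  have hM := h.M_pos r hr
  refine ⟨h1, ?_⟩
  rw [← h.slope r hr] at h1
  exact nonneg_of_mul_nonneg_right h1 (by positivity)

lemma P_pos_of_eps_pos (h : ClairautSystem R ρ M N ε e P V) {r : ℝ} (hr : 0 < r)
    (hrR : r ≤ R) (hε : ∀ s, r < s → s < R → 0 < ε s) : 0 < P r := by
  have := antitoneOn_Icc_of_hasDerivAt_nonpos (b := R) hr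
    (fun s hs _ => h.hasDerivAt_P s hs) (fun s h1 h2 => by
      have h3 := (h.slope_nonneg_of_eps_pos (hr.trans h1) (hε s h1 h2)).2
      have h4 := mul_nonneg h3 (h.rho_nonneg s (hr.trans h1))
      linarith)
  exact h.P_end.trans_le (this ⟨le_rfl, hrR⟩ ⟨hrR, le_rfl⟩ hrR)

lemma eps_pos (hR : 0 < R) (h : ClairautSystem R ρ M N ε e P V) {r : ℝ} (hr : 0 < r)
    (hrR : r ≤ R) : 0 < ε r := by
  have hcont : ContinuousOn ε (Icc r R) := fun s hs =>
    (h.hasDerivAt_eps s (hr.trans_le hs.1)).continuousAt.continuousWithinAt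
  have hεR : 0 < ε R := by
    have h1 := h.split R hR
    have h2 := h.V_end
    have h3 := h.P_end
    have hM := h.M_pos R hR
    have : 0 < ε R * (R ^ 2 * M R) := by rw [← mul_assoc, h1]; positivity
    exact pos_of_mul_pos_left this (by positivity)
  by_contra! hle
  have hcomp : IsCompact (Icc r R ∩ ε ⁻¹' Iic 0) :=
    isCompact_Icc.of_isClosed_subset
      (hcont.preimage_isClosed_of_isClosed isClosed_Icc isClosed_Iic) inter_subset_left
  obtain ⟨s, ⟨hs, hs0⟩, hmax⟩ := hcomp.exists_isGreatest ⟨r, ⟨le_rfl, hrR⟩, hle⟩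
  have hspos : 0 < s := hr.trans_le hs.1
  have hafter : ∀ x, s < x → x ≤ R → 0 < ε x := by
    intro x h1 h2
    by_contra! hx
    exact absurd (hmax ⟨⟨hs.1.trans h1.le, h2⟩, hx⟩) (not_le.2 h1)
  have hs_zero : ε s = 0 := by
    refine le_antisymm hs0 ?_
    have hsR : s < R := lt_of_le_of_ne hs.2 (by rintro rfl; exact absurd hs0 (not_le.2 hεR))
    have ht : Tendsto ε (𝓝[>] s) (𝓝 (ε s)) :=
      (h.hasDerivAt_eps s hspos).continuousAt.tendsto.mono_left nhdsWithin_le_nhds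
    refine ge_of_tendsto ht ?_
    filter_upwards [Ioo_mem_nhdsGT hsR] with x hx using (hafter x hx.1 hx.2.le).le
  have hbefore : ∀ x, 0 < x → x ≤ s → ε x = 0 := by
    intro x h1 h2
    have := h.sq_eps_monotoneOn ⟨h1, h2.trans hs.2⟩ ⟨hspos, hs.2⟩ h2
    simp only [hs_zero] at this
    nlinarith [sq_nonneg (ε x)]
  have he : e s = 0 := by
    have h1 : HasDerivWithinAt ε (e s) (Iio s) s := (h.hasDerivAt_eps s hspos).hasDerivWithinAt
    have h2 : HasDerivWithinAt ε 0 (Iio s) s := by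
      refine (hasDerivWithinAt_const s (Iio s) (0 : ℝ)).congr_of_eventuallyEq ?_ hs_zero
      filter_upwards [Ioo_mem_nhdsLT hspos] with x hx using hbefore x hx.1 hx.2.le
    exact (uniqueDiffWithinAt_Iio s).eq_deriv _ h1 h2
  have hP := h.P_pos_of_eps_pos hspos hs.2 fun x h1 h2 => hafter x h1 h2.le
  have h1 := h.split s hspos
  have h2 := h.slope s hspos
  rw [hs_zero] at h1
  rw [he] at h2
  have : 0 < s ^ 5 * P s := by positivity
  linarith

lemma P_pos (hR : 0 < R) (h : ClairautSystem R ρ M N ε e P V) {r : ℝ} (hr : 0 < r)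
    (hrR : r ≤ R) : 0 < P r :=
  h.P_pos_of_eps_pos hr hrR fun _ h1 h2 => h.eps_pos hR (hr.trans h1) h2.le

lemma V_pos (hR : 0 < R) (h : ClairautSystem R ρ M N ε e P V) {r : ℝ} (hr : 0 < r)
    (hrR : r ≤ R) : 0 < V r := by
  have hd : ∀ s, 0 < s → s < R → 0 < (5 * s ^ 4 * ε s + s ^ 5 * e s) * ρ s / 5 := by
    intro s hs hsR
    have h1 := h.eps_pos hR hs hsR.le
    have h2 := (h.slope_nonneg_of_eps_pos hs h1).2
    have h3 := h.rho_pos s hs hsR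
    positivity
  have hmono : MonotoneOn V (Ioc 0 R) :=
    monotoneOn_Ioc_of_hasDerivAt_nonneg h.hasDerivAt_V fun s h1 h2 => (hd s h1 h2).le
  have hstrict : StrictMonoOn V (Icc (r / 2) r) := by
    refine strictMonoOn_of_deriv_pos (convex_Icc _ _) (fun s hs =>
      (h.hasDerivAt_V s (by linarith [hs.1])).continuousAt.continuousWithinAt) fun s hs => ?_
    rw [interior_Icc] at hs
    rw [(h.hasDerivAt_V s (by linarith [hs.1])).deriv]
    exact hd s (by linarith [hs.1]) (by linarith [hs.2])
  have h1 := nonneg_of_monotoneOn_of_tendsto_zero hmono h.tendsto_V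
    (r := r / 2) ⟨by linarith, by linarith⟩
  exact h1.trans_lt (hstrict ⟨le_rfl, by linarith⟩ ⟨by linarith, le_rfl⟩ (by linarith))

/-- Near the centre the slope is negligible against `r⁵P`. -/
lemma eventually_slope_le (hR : 0 < R) (h : ClairautSystem R ρ M N ε e P V) {θ : ℝ}
    (hθ : 0 < θ) : ∀ᶠ r in 𝓝[>] 0, 3 * (r ^ 5 * P r) - 2 * V r ≤ θ * (r ^ 5 * P r) := by
  obtain ⟨C, hC⟩ := h.bounded
  have hPR := h.P_end
  have hCpos : 0 < C := hPR.trans_le ((le_abs_self _).trans (hC R hR).2)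
  have hsmall : ∀ᶠ r in 𝓝[>] 0,
      1 - r ^ 3 * ρ r / (3 * M r) < θ * P R / (3 * C) :=
    h.tendsto_ratio.eventually_lt_const (by positivity)
  obtain ⟨b, hb, hbsub⟩ := mem_nhdsGT_iff_exists_Ioo_subset.1 hsmall
  have hb0 : (0 : ℝ) < b := hb
  have hmono := monotoneOn_Ioc_of_hasDerivAt_nonneg (b := min b R)
    (fun s hs => ((hasDerivAt_pow 5 s).const_mul (θ * P R)).sub (h.hasDerivAt_slope s hs)) (by
      intro s hs hsb
      have h1 : 1 - s ^ 3 * ρ s / (3 * M s) < θ * P R / (3 * C) :=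
        hbsub ⟨hs, hsb.trans_le (min_le_left _ _)⟩
      have h0 := (h.one_sub_ratio_mem hs).1
      have h2 : P s ≤ C := (le_abs_self _).trans (hC s hs).2
      have h3 := h.P_pos hR hs (hsb.le.trans (min_le_right _ _))
      rw [lt_div_iff₀ (by positivity)] at h1
      have h4 : P s * (1 - s ^ 3 * ρ s / (3 * M s)) ≤ C * (1 - s ^ 3 * ρ s / (3 * M s)) :=
        mul_le_mul_of_nonneg_right h2 h0
      have h5 : 0 < s ^ 4 := by positivity
      simp only [Nat.cast_ofNat, Nat.reduceSub]
      nlinarith)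
  have h5 : Tendsto (fun r : ℝ => θ * P R * r ^ 5) (𝓝[>] 0) (𝓝 0) := by
    have : Tendsto (fun r : ℝ => θ * P R * r ^ 5) (𝓝 0) (𝓝 (θ * P R * 0 ^ 5)) :=
      Continuous.tendsto (by fun_prop) 0
    rw [zero_pow (by norm_num), mul_zero] at this
    exact this.mono_left nhdsWithin_le_nhds
  have ht := h5.sub h.tendsto_slope
  rw [sub_zero] at ht
  filter_upwards [Ioo_mem_nhdsGT (lt_min hb0 hR)] with r hr
  have h1 := nonneg_of_monotoneOn_of_tendsto_zero hmono ht (r := r) ⟨hr.1, hr.2.le⟩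
  have hPanti := antitoneOn_Icc_of_hasDerivAt_nonpos (b := R) hr.1
    (fun s hs _ => h.hasDerivAt_P s hs) (fun s h1 h2 => by
      have hs := hr.1.trans h1
      have h3 := (h.slope_nonneg_of_eps_pos hs (h.eps_pos hR hs h2.le)).2
      have h4 := mul_nonneg h3 (h.rho_nonneg s hs)
      linarith)
  have hrR : r ≤ R := hr.2.le.trans (min_le_right _ _)
  have h2 : P R ≤ P r := hPanti ⟨le_rfl, hrR⟩ ⟨hrR, le_rfl⟩ hrR
  have h3 : 0 ≤ θ * r ^ 5 := by have := hr.1; positivity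
  simp only [Pi.sub_apply] at h1
  nlinarith [mul_le_mul_of_nonneg_left h2 h3]

end ClairautSystem

/-- At a critical point of `y⁵t²` one has `y = 125t / (3(16t² + 37t - 4))`, and there
`y⁵t² ≤ (35/39)⁵(7/8)²`, with equality at `t = 7/8`. -/
lemma pow_seven_le {t : ℝ} (ht : 2 / 3 ≤ t) :
    t ^ 7 ≤ (35 / 39) ^ 5 * (49 / 64) * (3 / 125) ^ 5 * (16 * t ^ 2 + 37 * t - 4) ^ 5 := by
  obtain ⟨u, hu, rfl⟩ : ∃ u : ℝ, 0 ≤ u ∧ t = 2 / 3 + u := ⟨t - 2 / 3, by linarith, by ring⟩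
  rw [← sub_nonneg]
  have : (35 / 39) ^ 5 * (49 / 64) * (3 / 125) ^ 5 *
      (16 * (2 / 3 + u) ^ 2 + 37 * (2 / 3 + u) - 4) ^ 5 - (2 / 3 + u) ^ 7 =
      (u - 5 / 24) ^ 2 * (230229088 / 60901334325 + 7712674448 / 101502223875 * u
        + 77119972336 / 169170373125 * u ^ 2 + 361794837704 / 281950621875 * u ^ 3
        + 179619034502 / 93983540625 * u ^ 4 + 1177106290229 / 783196171875 * u ^ 5
        + 725350321024 / 1305326953125 * u ^ 6 + 150952137728 / 2175544921875 * u ^ 7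
        + 13492928512 / 3625908203125 * u ^ 8) := by
    ring
  rw [this]
  positivity

lemma log_combination_le_iff {n m p v c : ℝ} (hn : 0 < n) (hm : 0 < m) (hp : 0 < p) (hv : 0 < v)
    (hc : 0 < c) : 5 * log n - 5 * log m + 2 * log p - 2 * log v ≤ log c ↔
      n ^ 5 * p ^ 2 ≤ c * (m ^ 5 * v ^ 2) := by
  rw [← log_le_log_iff (x := n ^ 5 * p ^ 2) (by positivity) (by positivity), log_mul (by positivity) (by positivity),
    log_mul (by positivity) (by positivity), log_mul (by positivity) (by positivity), log_pow,
    log_pow, log_pow, log_pow]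
  push_cast
  constructor <;> intro h <;> linarith

/-- The sign of the logarithmic derivative of `(N/M)⁵(P/V)²` above the critical level. -/
lemma log_combination_deriv_nonpos {r ρ m n ε e p v : ℝ} (hr : 0 < r) (hρ : 0 ≤ ρ) (hm : 0 < m)
    (hn : 0 < n) (hp : 0 < p) (hv : 0 < v) (hsplit : ε * r ^ 2 * m = v + r ^ 5 * p)
    (hslope : r ^ 3 * m * e = 3 * (r ^ 5 * p) - 2 * v) (hE : 0 ≤ 3 * (r ^ 5 * p) - 2 * v)
    (hlt : (35 / 39) ^ 5 * (49 / 64) * (3 / 5) ^ 5 * (m ^ 5 * v ^ 2) < n ^ 5 * p ^ 2) :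
    5 * (r ^ 4 * ρ / n) - 5 * (r ^ 2 * ρ / m) + 2 * (-(e * ρ) / 5 / p)
      - 2 * ((5 * r ^ 4 * ε + r ^ 5 * e) * ρ / 5 / v) ≤ 0 := by
  obtain ⟨t, ht⟩ : ∃ t, t = r ^ 5 * p / v := ⟨_, rfl⟩
  obtain ⟨A, hA⟩ : ∃ A, A = r ^ 2 * m / n := ⟨_, rfl⟩
  have htpos : 0 < t := by rw [ht]; positivity
  have hApos : 0 < A := by rw [hA]; positivity
  have ht23 : 2 / 3 ≤ t := by rw [ht, le_div_iff₀ hv]; linarith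
  have hp' : p = t * v / r ^ 5 := by rw [ht]; field_simp
  have hn' : n = r ^ 2 * m / A := by rw [hA]; field_simp
  have he' : e = (3 * t - 2) * v / (r ^ 3 * m) := by
    rw [eq_div_iff (by positivity)]
    rw [hp'] at hslope
    field_simp at hslope ⊢
    linarith
  have hε' : ε = (1 + t) * v / (r ^ 2 * m) := by
    rw [eq_div_iff (by positivity)]
    rw [hp'] at hsplit
    field_simp at hsplit ⊢
    linarith
  have key : 25 * A * t ≤ 16 * t ^ 2 + 37 * t - 4 := by
    by_contra! hcon
    have h0 : 0 ≤ 16 * t ^ 2 + 37 * t - 4 := by nlinarith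
    have h1 := pow_lt_pow_left₀ hcon h0 (by norm_num : 5 ≠ 0)
    have h2 := pow_seven_le ht23
    have h3 : t ^ 5 * t ^ 2 ≤ t ^ 5 * ((35 / 39) ^ 5 * (49 / 64) * (3 / 5) ^ 5 * A ^ 5) := by
      nlinarith
    have h4 := le_of_mul_le_mul_left h3 (by positivity)
    rw [hn', hp'] at hlt
    have h5 : (r ^ 2 * m / A) ^ 5 * (t * v / r ^ 5) ^ 2 = m ^ 5 * v ^ 2 * (t ^ 2 / A ^ 5) := by
      field_simp
    rw [h5, mul_comm] at hlt
    have h6 := lt_of_mul_lt_mul_left hlt (by positivity)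
    rw [lt_div_iff₀ (by positivity)] at h6
    linarith
  have hform : 5 * (r ^ 4 * ρ / n) - 5 * (r ^ 2 * ρ / m) + 2 * (-(e * ρ) / 5 / p)
      - 2 * ((5 * r ^ 4 * ε + r ^ 5 * e) * ρ / 5 / v) =
      -(ρ * r ^ 2 / (5 * m * t) * (16 * t ^ 2 + 37 * t - 4 - 25 * A * t)) := by
    rw [hn', hp', he', hε']
    field_simp
    ring
  rw [hform, neg_nonpos]
  exact mul_nonneg (by positivity) (sub_nonneg.2 key)

namespace ClairautSystem

variable {R : ℝ} {ρ M N ε e P V : ℝ → ℝ}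

theorem moment_ratio_le (hR : 0 < R) (h : ClairautSystem R ρ M N ε e P V) :
    N R ^ 5 * P R ^ 2 ≤ (35 / 39) ^ 5 * (49 / 64) * (3 / 5) ^ 5 * (M R ^ 5 * V R ^ 2) := by
  have hc : (0 : ℝ) < (35 / 39) ^ 5 * (49 / 64) * (3 / 5) ^ 5 := by norm_num
  have hiff := fun r (hr : 0 < r) (hrR : r ≤ R) =>
    log_combination_le_iff (h.N_pos r hr) (h.M_pos r hr) (h.P_pos hR hr hrR) (h.V_pos hR hr hrR) hc
  obtain ⟨a, hsl, ha⟩ := ((h.eventually_slope_le hR (θ := 1 / 1000) (by norm_num)).and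
    (Ioo_mem_nhdsGT hR)).exists
  have hbase : N a ^ 5 * P a ^ 2 ≤
      (35 / 39) ^ 5 * (49 / 64) * (3 / 5) ^ 5 * (M a ^ 5 * V a ^ 2) := by
    have ha0 := ha.1
    have hM := h.M_pos a ha0
    have hP := h.P_pos hR ha0 ha.2.le
    have h1 : N a ^ 5 ≤ (3 / 5 * (a ^ 2 * M a)) ^ 5 :=
      pow_le_pow_left₀ (h.N_pos a ha0).le (by linarith [h.N_le a ha0]) 5
    have h2 : (a ^ 5 * P a) ^ 2 ≤ (2000 / 2999 * V a) ^ 2 :=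
      pow_le_pow_left₀ (by positivity) (by linarith) 2
    calc N a ^ 5 * P a ^ 2 ≤ (3 / 5 * (a ^ 2 * M a)) ^ 5 * P a ^ 2 := by gcongr
      _ = (3 / 5) ^ 5 * M a ^ 5 * (a ^ 5 * P a) ^ 2 := by ring
      _ ≤ (3 / 5) ^ 5 * M a ^ 5 * (2000 / 2999 * V a) ^ 2 := by gcongr
      _ = (2000 / 2999) ^ 2 * (3 / 5) ^ 5 * (M a ^ 5 * V a ^ 2) := by ring
      _ ≤ _ := by
        have : 0 ≤ M a ^ 5 * V a ^ 2 := by positivity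
        exact mul_le_mul_of_nonneg_right (by norm_num) this
  rw [← hiff R hR le_rfl]
  refine le_of_hasDerivAt_nonpos_above
    (f := fun r => 5 * log (N r) - 5 * log (M r) + 2 * log (P r) - 2 * log (V r)) ha.1 ha.2.le
    (fun r hr hrR => ((((h.hasDerivAt_N r hr).log (h.N_pos r hr).ne').const_mul 5).sub
      (((h.hasDerivAt_M r hr).log (h.M_pos r hr).ne').const_mul 5)).add
      (((h.hasDerivAt_P r hr).log (h.P_pos hR hr hrR).ne').const_mul 2) |>.sub
      (((h.hasDerivAt_V r hr).log (h.V_pos hR hr hrR).ne').const_mul 2))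
    ((hiff a ha.1 ha.2.le).2 hbase) fun r hr hrR hlt => ?_
  have hr0 := ha.1.trans hr
  rw [← not_le, hiff r hr0 hrR.le, not_le] at hlt
  exact log_combination_deriv_nonpos hr0 (h.rho_nonneg r hr0) (h.M_pos r hr0) (h.N_pos r hr0)
    (h.P_pos hR hr0 hrR.le) (h.V_pos hR hr0 hrR.le) (h.split r hr0) (h.slope r hr0)
    (h.slope_nonneg_of_eps_pos hr0 (h.eps_pos hR hr0 hrR.le)).1 hlt

end ClairautSystem

lemma hasDerivAt_primitive_of_continuous {f : ℝ → ℝ} (hf : Continuous f) (r : ℝ) :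
    HasDerivAt (fun r => ∫ a in (0 : ℝ)..r, f a) (f r) r :=
  intervalIntegral.integral_hasDerivAt_right (hf.intervalIntegrable _ _)
    hf.stronglyMeasurable.stronglyMeasurableAtFilter hf.continuousAt

/-- Moments of a nonincreasing profile are squeezed between those of constant profiles. -/
lemma moment_bounds {ρ : ℝ → ℝ} (hc : Continuous ρ) (hmono : AntitoneOn ρ (Ici 0)) {r : ℝ}
    (hr : 0 < r) : r ^ 3 * ρ r ≤ 3 * ∫ a in (0 : ℝ)..r, a ^ 2 * ρ a ∧
      3 * (∫ a in (0 : ℝ)..r, a ^ 2 * ρ a) ≤ r ^ 3 * ρ 0 := by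
  have hconst : ∀ c : ℝ, ∫ a in (0 : ℝ)..r, a ^ 2 * c = r ^ 3 / 3 * c := by
    intro c
    rw [intervalIntegral.integral_mul_const, integral_pow]
    norm_num
  have hi : ∀ g : ℝ → ℝ, Continuous g →
      IntervalIntegrable (fun a => a ^ 2 * g a) volume 0 r := fun g hg =>
    Continuous.intervalIntegrable (by fun_prop) _ _
  constructor
  · have := intervalIntegral.integral_mono_on hr.le (hi (fun _ => ρ r) continuous_const) (hi ρ hc)
      fun a ha => mul_le_mul_of_nonneg_left (hmono ha.1 hr.le ha.2) (sq_nonneg a)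
    rw [hconst] at this
    linarith
  · have := intervalIntegral.integral_mono_on hr.le (hi ρ hc) (hi (fun _ => ρ 0) continuous_const)
      fun a ha => mul_le_mul_of_nonneg_left (hmono self_mem_Ici ha.1 ha.1) (sq_nonneg a)
    rw [hconst] at this
    linarith

lemma moment_pos {ρ : ℝ → ℝ} (hc : Continuous ρ) {R : ℝ} (hR : 0 < R)
    (hpos : ∀ r, 0 ≤ r → r < R → 0 < ρ r) (hnonneg : ∀ r, 0 ≤ r → 0 ≤ ρ r) (n : ℕ) {r : ℝ}
    (hr : 0 < r) : 0 < ∫ a in (0 : ℝ)..r, a ^ n * ρ a := by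
  refine intervalIntegral.integral_pos hr (by fun_prop)
    (fun a ha => mul_nonneg (pow_nonneg ha.1.le n) (hnonneg a ha.1.le)) ⟨min r R / 2, ?_, ?_⟩
  · have h1 := lt_min hr hR
    exact ⟨by linarith, by linarith [min_le_left r R]⟩
  · have h1 := lt_min hr hR
    have h2 := hpos (min r R / 2) (by linarith) (by linarith [min_le_right r R])
    positivity

lemma fourth_moment_le {ρ : ℝ → ℝ} (hc : Continuous ρ) (hmono : AntitoneOn ρ (Ici 0)) {r : ℝ}
    (hr : 0 < r) : 5 * (∫ a in (0 : ℝ)..r, a ^ 4 * ρ a) ≤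
      3 * r ^ 2 * ∫ a in (0 : ℝ)..r, a ^ 2 * ρ a := by
  have hM := hasDerivAt_primitive_of_continuous (f := fun a => a ^ 2 * ρ a) (by fun_prop)
  have hN := hasDerivAt_primitive_of_continuous (f := fun a => a ^ 4 * ρ a) (by fun_prop)
  have hd := fun s => ((((hasDerivAt_pow 2 s).const_mul 3).mul (hM s)).sub ((hN s).const_mul 5))
  have hm := monotoneOn_Ioc_of_hasDerivAt_nonneg (b := r) (fun s _ => hd s) (by
    intro s hs _
    have h1 := (moment_bounds hc hmono hs).1
    simp only [Nat.cast_ofNat, Nat.add_one_sub_one, pow_one]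
    nlinarith)
  have ht := (hd 0).continuousAt.tendsto.mono_left
    (nhdsWithin_le_nhds (s := Ioi (0 : ℝ)))
  simp only [Pi.sub_apply, Pi.mul_apply, intervalIntegral.integral_same, mul_zero, sub_zero] at ht
  have := nonneg_of_monotoneOn_of_tendsto_zero hm ht (r := r) ⟨hr, le_rfl⟩
  simp only [Pi.sub_apply, Pi.mul_apply] at this
  linarith

lemma deriv_eq_zero_of_eventually_const {ρ : ℝ → ℝ} {R : ℝ} (hzero : ∀ r, R ≤ r → ρ r = 0)
    {r : ℝ} (hr : R < r) : deriv ρ r = 0 := by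
  have : ρ =ᶠ[𝓝 r] fun _ => 0 := by
    filter_upwards [Ioi_mem_nhds hr] with x hx using hzero x (le_of_lt hx)
  rw [this.deriv_eq, deriv_const]

/-- A bounded measurable solution of Clairaut's integral equation is differentiable and solves
the first order system. -/
lemma clairautSystem_of_clairautEq {R G Ω : ℝ} (hR : 0 < R) (hG : 0 < G) (hΩ : 0 < Ω)
    {ρ : ℝ → ℝ} (hC1 : ContDiff ℝ 1 ρ) (hmono : AntitoneOn ρ (Ici 0))
    (hpos : ∀ r : ℝ, 0 ≤ r → r < R → 0 < ρ r) (hzero : ∀ r : ℝ, R ≤ r → ρ r = 0)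
    {ε : ℝ → ℝ} (hεmeas : Measurable ε) (hεbd : ∃ C : ℝ, ∀ r : ℝ, 0 ≤ r → |ε r| ≤ C)
    (hcl : ClairautEq G Ω ρ ε)
    (hK : (∫ a in (0 : ℝ)..R, a ^ 5 * ε a * deriv ρ a) < 0) :
    ClairautSystem R ρ (fun r => ∫ a in (0 : ℝ)..r, a ^ 2 * ρ a)
      (fun r => ∫ a in (0 : ℝ)..r, a ^ 4 * ρ a) ε (deriv ε)
      (fun r => Ω ^ 2 / (8 * π * G) - (∫ a in Ioi r, ε a * deriv ρ a) / 5 - ε r * ρ r / 5)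
      (fun r => -(∫ a in (0 : ℝ)..r, a ^ 5 * ε a * deriv ρ a) / 5 + r ^ 5 * ε r * ρ r / 5) := by
  obtain ⟨C, hC⟩ := hεbd
  have hc : Continuous ρ := hC1.continuous
  have hdc : Continuous (deriv ρ) := hC1.continuous_deriv le_rfl
  have hρd : ∀ r, HasDerivAt ρ (deriv ρ r) r := fun r =>
    (hC1.differentiable (by norm_num) r).hasDerivAt
  have hnonneg : ∀ r, 0 ≤ r → 0 ≤ ρ r := fun r hr => by
    rcases lt_or_ge r R with h | h
    · exact (hpos r hr h).le
    · exact (hzero r h).ge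
  have hρle : ∀ r, 0 ≤ r → ρ r ≤ ρ 0 := fun r hr => hmono self_mem_Ici hr hr
  have hMpos : ∀ r : ℝ, 0 < r → 0 < ∫ a in (0 : ℝ)..r, a ^ 2 * ρ a := fun r hr =>
    moment_pos hc hR hpos hnonneg 2 hr
  have hMd := hasDerivAt_primitive_of_continuous (f := fun a => a ^ 2 * ρ a) (by fun_prop)
  have hεint : ∀ r : ℝ, 0 ≤ r → IntervalIntegrable ε volume 0 r := fun r hr => by
    rw [intervalIntegrable_iff_integrableOn_Ioc_of_le hr]
    refine Measure.integrableOn_of_bounded (M := C) (by simp) hεmeas.aestronglyMeasurable ?_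
    filter_upwards [ae_restrict_mem measurableSet_Ioc] with a ha using hC a ha.1.le
  have hKint : ∀ r : ℝ, 0 ≤ r →
      IntervalIntegrable (fun a => a ^ 5 * ε a * deriv ρ a) volume 0 r := fun r hr => by
    have := (hεint r hr).continuousOn_mul (g := fun a => a ^ 5 * deriv ρ a) (by fun_prop)
    exact this.congr fun a _ => by ring
  have hLint' : ∀ r : ℝ, 0 ≤ r →
      IntervalIntegrable (fun a => ε a * deriv ρ a) volume 0 r := fun r hr =>
    (hεint r hr).mul_continuousOn hdc.continuousOn
  have htail : ∀ a, R < a → ε a * deriv ρ a = 0 := fun a ha => by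
    rw [deriv_eq_zero_of_eventually_const hzero ha, mul_zero]
  have hLint : IntegrableOn (fun a => ε a * deriv ρ a) (Ioi 0) := by
    rw [← Ioc_union_Ioi_eq_Ioi hR.le]
    refine IntegrableOn.union ?_ ?_
    · exact (intervalIntegrable_iff_integrableOn_Ioc_of_le hR.le).1 (hLint' R hR.le)
    · exact integrableOn_zero.congr_fun (fun a ha => (htail a ha).symm) measurableSet_Ioi
  set L : ℝ → ℝ := fun r => ∫ a in Ioi r, ε a * deriv ρ a with hL
  set K : ℝ → ℝ := fun r => ∫ a in (0 : ℝ)..r, a ^ 5 * ε a * deriv ρ a with hKdef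
  set M : ℝ → ℝ := fun r => ∫ a in (0 : ℝ)..r, a ^ 2 * ρ a with hM
  set c : ℝ := Ω ^ 2 / (8 * π * G) with hcdef
  have hcpos : 0 < c := by positivity
  have hLeq : ∀ r, 0 ≤ r → L r = L 0 - ∫ a in (0 : ℝ)..r, ε a * deriv ρ a := fun r hr => by
    have := intervalIntegral.integral_interval_add_Ioi hLint
      (hLint.mono_set (Ioi_subset_Ioi hr))
    simp only [hL]
    linarith
  have heq : ∀ r, 0 < r → ε r * r ^ 2 * M r = c * r ^ 5 - K r / 5 - r ^ 5 * L r / 5 := by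
    intro r hr
    have h := hcl r hr
    have h1 : c * r ^ 5 = Ω ^ 2 * r ^ 5 / 2 / (4 * π * G) := by
      rw [hcdef]; field_simp; ring
    rw [h1, ← h]
    field_simp
    ring
  have hcontOn : ∀ f : ℝ → ℝ, (∀ r, 0 ≤ r → IntervalIntegrable f volume 0 r) → ∀ b : ℝ, 0 ≤ b →
      ContinuousOn (fun r => ∫ a in (0 : ℝ)..r, f a) (Icc 0 b) := fun f hf b hb => by
    have := intervalIntegral.continuousOn_primitive_interval (f := f) (a := 0) (b := b) (μ := volume)
      (by
        rw [uIcc_of_le hb, integrableOn_Icc_iff_integrableOn_Ioc]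
        exact (intervalIntegrable_iff_integrableOn_Ioc_of_le hb).1 (hf b hb))
    rwa [uIcc_of_le hb] at this
  have hcontAt : ∀ f : ℝ → ℝ, (∀ r, 0 ≤ r → IntervalIntegrable f volume 0 r) → ∀ r : ℝ, 0 < r →
      ContinuousAt (fun r => ∫ a in (0 : ℝ)..r, f a) r := fun f hf r hr =>
    (hcontOn f hf (r + 1) (by linarith)).continuousAt (Icc_mem_nhds hr (by linarith))
  have hεeq : ∀ r, 0 < r → ε =ᶠ[𝓝 r] fun s => (c * s ^ 5 - K s / 5 -
      s ^ 5 * (L 0 - ∫ a in (0 : ℝ)..s, ε a * deriv ρ a) / 5) / (s ^ 2 * M s) := by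
    intro r hr
    filter_upwards [Ioi_mem_nhds hr] with s hs
    have hs : 0 < s := hs
    have hMs := hMpos s hs
    rw [← hLeq s hs.le, ← heq s hs, eq_div_iff (by positivity)]
    ring
  have hεcont : ∀ r, 0 < r → ContinuousAt ε r := by
    intro r hr
    have hMr := hMpos r hr
    have h1 := hcontAt _ hKint r hr
    have h2 := hcontAt _ hLint' r hr
    have h3 := (hMd r).continuousAt
    refine ContinuousAt.congr ?_ (hεeq r hr).symm
    refine ContinuousAt.div ?_ ?_ (by positivity)
    · exact ((continuousAt_const.mul (continuousAt_id.pow 5)).sub (h1.div_const 5)).sub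
        (((continuousAt_id.pow 5).mul (continuousAt_const.sub h2)).div_const 5)
    · exact (continuousAt_id.pow 2).mul h3
  have hKd : ∀ r, 0 < r → HasDerivAt K (r ^ 5 * ε r * deriv ρ r) r := fun r hr =>
    intervalIntegral.integral_hasDerivAt_right (hKint r hr.le)
      (Measurable.stronglyMeasurable (by fun_prop)).stronglyMeasurableAtFilter
      (((continuousAt_id.pow 5).mul (hεcont r hr)).mul hdc.continuousAt)
  have hLd' : ∀ r, 0 < r →
      HasDerivAt (fun s => L 0 - ∫ a in (0 : ℝ)..s, ε a * deriv ρ a) (-(ε r * deriv ρ r)) r :=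
    fun r hr => (intervalIntegral.integral_hasDerivAt_right (hLint' r hr.le)
      (Measurable.stronglyMeasurable (by fun_prop)).stronglyMeasurableAtFilter
      ((hεcont r hr).mul hdc.continuousAt)).const_sub _
  have hLd : ∀ r, 0 < r → HasDerivAt L (-(ε r * deriv ρ r)) r := fun r hr => by
    refine (hLd' r hr).congr_of_eventuallyEq ?_
    filter_upwards [Ioi_mem_nhds hr] with s hs using hLeq s (le_of_lt hs)
  have hεd : ∀ r, 0 < r → HasDerivAt ε (deriv ε r) r := by
    intro r hr
    have hMr := hMpos r hr
    have h1 := ((((hasDerivAt_pow 5 r).const_mul c).sub ((hKd r hr).div_const 5)).sub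
      (((hasDerivAt_pow 5 r).mul (hLd' r hr)).div_const 5)).div
      ((hasDerivAt_pow 2 r).mul (hMd r)) (by simp only [Pi.mul_apply]; positivity)
    exact (DifferentiableAt.congr_of_eventuallyEq h1.differentiableAt (hεeq r hr)).hasDerivAt
  have hbound : ∀ r, 0 < r → |ε r * ρ r| ≤ C * ρ 0 := fun r hr => by
    rw [abs_mul, abs_of_nonneg (hnonneg r hr.le)]
    exact mul_le_mul (hC r hr.le) (hρle r hr.le) (hnonneg r hr.le)
      ((abs_nonneg _).trans (hC r hr.le))
  refine
    { hasDerivAt_M := fun r _ => hMd r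
      hasDerivAt_N := fun r _ =>
        hasDerivAt_primitive_of_continuous (f := fun a => a ^ 4 * ρ a) (by fun_prop) r
      hasDerivAt_eps := hεd
      hasDerivAt_P := fun r hr => ?_
      hasDerivAt_V := fun r hr => ?_
      M_pos := hMpos
      N_pos := fun r hr => moment_pos hc hR hpos hnonneg 4 hr
      rho_nonneg := fun r hr => hnonneg r hr.le
      rho_pos := fun r hr => hpos r hr.le
      rho_le := fun r hr => (moment_bounds hc hmono hr).1
      N_le := fun r hr => fourth_moment_le hc hmono hr
      split := fun r hr => ?_
      slope := fun r hr => ?_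
      bounded := ?_
      tendsto_V := ?_
      tendsto_ratio := ?_
      P_end := ?_
      V_end := ?_ }
  · refine ((((hLd r hr).div_const 5).const_sub c).sub
      (((hεd r hr).mul (hρd r)).div_const 5)).congr_deriv ?_
    ring
  · refine (((hKd r hr).neg.div_const 5).add
      ((((hasDerivAt_pow 5 r).mul (hεd r hr)).mul (hρd r)).div_const 5)).congr_deriv ?_
    simp only [Pi.mul_apply]
    push_cast
    ring
  · rw [heq r hr]; ring
  · have h1 := ((hεd r hr).mul (hasDerivAt_pow 2 r)).mul (hMd r)
    have h2 := (((hasDerivAt_pow 5 r).const_mul c).sub ((hKd r hr).div_const 5)).sub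
      (((hasDerivAt_pow 5 r).mul (hLd r hr)).div_const 5)
    have h3 := h1.unique (h2.congr_of_eventuallyEq (by
      filter_upwards [Ioi_mem_nhds hr] with s hs using heq s hs))
    have h4 := heq r hr
    simp only [Pi.mul_apply] at h3
    push_cast at h3
    linear_combination r * h3 - 2 * h4
  · refine ⟨max C (c + (∫ a in Ioi (0 : ℝ), |ε a * deriv ρ a|) / 5 + C * ρ 0 / 5), fun r hr =>
      ⟨(hC r hr.le).trans (le_max_left _ _), le_trans ?_ (le_max_right _ _)⟩⟩
    have h1 : |L r| ≤ ∫ a in Ioi (0 : ℝ), |ε a * deriv ρ a| :=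
      (norm_integral_le_integral_norm _).trans
        (setIntegral_mono_set hLint.norm (ae_of_all _ fun _ => norm_nonneg _)
          (Ioi_subset_Ioi hr.le).eventuallyLE)
    have h2 := hbound r hr
    rw [abs_le] at h1 h2 ⊢
    constructor <;> linarith [h1.1, h1.2, h2.1, h2.2]
  · have h1 : Tendsto K (𝓝[>] 0) (𝓝 0) := by
      have := (hcontOn _ hKint 1 zero_le_one) 0 ⟨le_rfl, zero_le_one⟩
      have h2 := this.tendsto.mono_left (nhdsWithin_mono 0 Ioc_subset_Icc_self)
      rw [nhdsWithin_Ioc_eq_nhdsGT zero_lt_one, intervalIntegral.integral_same] at h2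
      exact h2
    have h5 : Tendsto (fun r : ℝ => r ^ 5) (𝓝[>] 0) (𝓝 0) := by
      have : Tendsto (fun r : ℝ => r ^ 5) (𝓝 0) (𝓝 (0 ^ 5)) := (continuous_pow 5).tendsto 0
      rw [zero_pow (by norm_num)] at this
      exact this.mono_left nhdsWithin_le_nhds
    have hb : IsBoundedUnder (· ≤ ·) (𝓝[>] 0) ((‖·‖) ∘ fun r => ε r * ρ r) :=
      isBoundedUnder_of_eventually_le (a := C * ρ 0) (by
        filter_upwards [self_mem_nhdsWithin] with r hr using hbound r hr)
    have := (h1.neg.div_const 5).add ((h5.zero_mul_isBoundedUnder_le hb).div_const 5)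
    rw [neg_zero, zero_div, add_zero] at this
    exact this.congr fun r => by simp only [hKdef]; ring
  · have hρ0 := hpos 0 le_rfl hR
    have hlim : Tendsto (fun r => 1 - ρ r / ρ 0) (𝓝[>] 0) (𝓝 0) := by
      have : Tendsto (fun r => 1 - ρ r / ρ 0) (𝓝 0) (𝓝 (1 - ρ 0 / ρ 0)) :=
        Continuous.tendsto (by fun_prop) 0
      rw [div_self hρ0.ne', sub_self] at this
      exact this.mono_left nhdsWithin_le_nhds
    refine squeeze_zero' ?_ ?_ hlim
    · filter_upwards [self_mem_nhdsWithin] with r hr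
      have hMr := hMpos r hr
      rw [sub_nonneg, div_le_one (by positivity)]
      exact (moment_bounds hc hmono hr).1
    · filter_upwards [self_mem_nhdsWithin] with r hr
      have hr : 0 < r := hr
      have hMr := hMpos r hr
      have h1 := (moment_bounds hc hmono hr).2
      have h2 := hnonneg r hr.le
      refine sub_le_sub_left ?_ 1
      rw [div_le_div_iff₀ hρ0 (by positivity)]
      nlinarith
  · have h1 : L R = 0 := setIntegral_eq_zero_of_forall_eq_zero fun a ha => htail a ha
    change 0 < c - L R / 5 - ε R * ρ R / 5
    rw [h1, hzero R le_rfl]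
    simpa using hcpos
  · simp only [hzero R le_rfl]
    linarith

/-- **upper bound.**
`γ/γ_I ≤ √(35/39)·(8575/8112) ≈ 1.001401`, for every value of `R_I/R ∈ (0,1]`. -/
theorem stmt_11 (R G Ω : ℝ) (hR : 0 < R) (hG : 0 < G) (hΩ : 0 < Ω)
    (ρ : ℝ → ℝ) (hC2 : ContDiff ℝ 2 ρ) (hmono : AntitoneOn ρ (Ici 0))
    (hpos : ∀ r : ℝ, 0 ≤ r → r < R → 0 < ρ r) (hzero : ∀ r : ℝ, R ≤ r → ρ r = 0)
    (ε : ℝ → ℝ) (hεmeas : Measurable ε) (hεbd : ∃ C : ℝ, ∀ r : ℝ, 0 ≤ r → |ε r| ≤ C)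
    (hcl : ClairautEq G Ω ρ ε) :
    gammaOf Ω ρ ε R / gammaIof G ρ R ≤ Real.sqrt (35 / 39) * (8575 / 8112) := by
  have hnonneg : ∀ r, 0 ≤ r → 0 ≤ ρ r := fun r hr => by
    rcases lt_or_ge r R with h | h
    · exact (hpos r hr h).le
    · exact (hzero r h).ge
  have hM := moment_pos hC2.continuous hR hpos hnonneg 2 hR
  have hN := moment_pos hC2.continuous hR hpos hnonneg 4 hR
  unfold gammaOf gammaIof RIof inertiaOf massOf
  rcases le_or_gt 0 (∫ a in (0 : ℝ)..R, a ^ 5 * ε a * deriv ρ a) with hK | hK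
  · refine le_trans (div_nonpos_of_nonpos_of_nonneg (div_nonpos_of_nonpos_of_nonneg ?_ ?_) ?_)
      (by positivity)
    · rw [neg_nonpos]; positivity
    · positivity
    · positivity
  have hsys := clairautSystem_of_clairautEq hR hG hΩ (hC2.of_le (by norm_num)) hmono hpos hzero
    hεmeas hεbd hcl hK
  have hmain := hsys.moment_ratio_le hR
  have htail : ∫ a in Ioi R, ε a * deriv ρ a = 0 :=
    setIntegral_eq_zero_of_forall_eq_zero fun a ha => by
      rw [deriv_eq_zero_of_eventually_const hzero ha, mul_zero]
  simp only [hzero R le_rfl, htail, mul_zero, zero_div, sub_zero, add_zero] at hmain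
  set M := ∫ a in (0 : ℝ)..R, a ^ 2 * ρ a
  set N := ∫ a in (0 : ℝ)..R, a ^ 4 * ρ a
  obtain ⟨v, hv⟩ : ∃ v, v = -(∫ a in (0 : ℝ)..R, a ^ 5 * ε a * deriv ρ a) / 5 := ⟨_, rfl⟩
  have hK' : ∫ a in (0 : ℝ)..R, a ^ 5 * ε a * deriv ρ a = -(5 * v) := by rw [hv]; ring
  have hvpos : 0 < v := by rw [hv]; linarith
  rw [← hv] at hmain
  rw [hK']
  have hrad : 5 * (8 * π / 3 * N) / (2 * (4 * π * M)) = 5 / 3 * N / M := by field_simp; ring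
  rw [hrad]
  obtain ⟨x, hx⟩ : ∃ x, x = √(5 / 3 * N / M) := ⟨_, rfl⟩
  have hxpos : 0 < x := by rw [hx]; positivity
  have hx2 : x ^ 2 = 5 / 3 * N / M := by rw [hx]; exact Real.sq_sqrt (by positivity)
  obtain ⟨c, hc⟩ : ∃ c, c = Ω ^ 2 / (8 * π * G) := ⟨_, rfl⟩
  have hΩc : Ω ^ 2 = 8 * π * G * c := by rw [hc]; field_simp
  rw [← hc] at hmain
  rw [← hx, hΩc]
  have hform : -(15 * (8 * π / 3 * N) * (8 * π * G * c)) / (8 * π * -(5 * v)) /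
      (4 / 5 * G * (4 * π * M) / x ^ 3) = 5 / 2 * N * c * x ^ 3 / (M * v) := by
    field_simp
    ring
  rw [hform]
  refine le_of_sq_le_sq ?_ (by positivity)
  have hsq : (5 / 2 * N * c * x ^ 3 / (M * v)) ^ 2 =
      9 / 4 * (5 / 3) ^ 5 * (N ^ 5 * c ^ 2 / (M ^ 5 * v ^ 2)) := by
    have : (5 / 2 * N * c * x ^ 3 / (M * v)) ^ 2 =
      25 / 4 * N ^ 2 * c ^ 2 * (x ^ 2) ^ 3 / (M * v) ^ 2 := by ring
    rw [this, hx2]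
    field_simp
    ring
  rw [hsq, mul_pow, Real.sq_sqrt (by norm_num)]
  have h1 : N ^ 5 * c ^ 2 / (M ^ 5 * v ^ 2) ≤ (35 / 39) ^ 5 * (49 / 64) * (3 / 5) ^ 5 := by
    rw [div_le_iff₀ (by positivity)]; exact hmain
  refine (mul_le_mul_of_nonneg_left h1 (by norm_num)).trans ?_
  norm_num
end

section
/- For every β ∈ (0,1] and every real Γ ≥ (8575/8112)·√(35/39), one has 18·β¹⁰ + (125·β³ − 111·β⁵)·Γ − 32·Γ² ≤ 0. Moreover, the positive root of the quadratic Γ ↦ 18β¹⁰ + (125β³ − 111β⁵)Γ − 32Γ², namely Γ₁(β) = β³·(125 − 111β² + 5√5·√(117β⁴ − 222β² + 125))/64, attains its maximum over β ∈ (0,1] at β = √(35/39), where it equals (8575/8112)·√(35/39). -/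
open Real

/-- The positive root of the quadratic `Γ ↦ 18β¹⁰ + (125β³ − 111β⁵)Γ − 32Γ²`. -/
noncomputable def Gamma1 (β : ℝ) : ℝ :=
  β ^ 3 * (125 - 111 * β ^ 2 +
    5 * Real.sqrt 5 * Real.sqrt (117 * β ^ 4 - 222 * β ^ 2 + 125)) / 64

lemma octic_cofactor_nonpos {t : ℝ} (ht : 0 ≤ t) (ht2 : t ^ 2 ≤ 39 / 35) :
    -98 - 196 * t - 294 * t ^ 2 - 67 * t ^ 3 + 160 * t ^ 4 + 128 * t ^ 5 + 96 * t ^ 6 +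
      64 * t ^ 7 + 32 * t ^ 8 ≤ 0 := by
  have h4 : t ^ 4 ≤ (39 / 35) * t ^ 2 := by nlinarith [sq_nonneg t]
  have h6 : t ^ 6 ≤ (39 / 35) * t ^ 4 := by nlinarith [pow_nonneg ht 4]
  have h8 : t ^ 8 ≤ (39 / 35) * t ^ 6 := by nlinarith [pow_nonneg ht 6]
  have h3 : t ^ 3 ≤ (39 / 35) * t := by nlinarith
  have h5 : t ^ 5 ≤ (39 / 35) * t ^ 3 := by nlinarith [pow_nonneg ht 3]
  have h7 : t ^ 7 ≤ (39 / 35) * t ^ 5 := by nlinarith [pow_nonneg ht 5]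
  linarith

lemma quadratic_at_max_nonpos {β : ℝ} (hβ : 0 < β) (hβ1 : β ≤ 1) :
    18 * β ^ 10 + (125 * β ^ 3 - 111 * β ^ 5) * (8575 / 8112 * √(35 / 39)) -
      32 * (8575 / 8112 * √(35 / 39)) ^ 2 ≤ 0 := by
  have hs : 0 < √(35 / 39 : ℝ) := by positivity
  have hs2 : √(35 / 39 : ℝ) ^ 2 = 35 / 39 := Real.sq_sqrt (by norm_num)
  set s := √(35 / 39 : ℝ)
  obtain ⟨t, rfl⟩ : ∃ t, β = s * t := ⟨β / s, by field_simp⟩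
  have ht : 0 < t := pos_of_mul_pos_right hβ hs.le
  have ht2 : t ^ 2 ≤ 39 / 35 := by
    have h : (s * t) ^ 2 ≤ 1 := pow_le_one₀ hβ.le hβ1
    rw [mul_pow, hs2] at h
    linarith
  have hs4 : s ^ 4 = (35 / 39) ^ 2 := by rw [← hs2]; ring
  have hs6 : s ^ 6 = (35 / 39) ^ 3 := by rw [← hs2]; ring
  have hs10 : s ^ 10 = (35 / 39) ^ 5 := by rw [← hs2]; ring
  have key : 18 * (s * t) ^ 10 + (125 * (s * t) ^ 3 - 111 * (s * t) ^ 5) * (8575 / 8112 * s) -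
      32 * (8575 / 8112 * s) ^ 2 = (35 / 39) * (1500625 / 4112784) * (t - 1) ^ 2 *
        (-98 - 196 * t - 294 * t ^ 2 - 67 * t ^ 3 + 160 * t ^ 4 + 128 * t ^ 5 + 96 * t ^ 6 +
          64 * t ^ 7 + 32 * t ^ 8) := by
    linear_combination 18 * t ^ 10 * hs10 - 111 * t ^ 5 * (8575 / 8112) * hs6 +
      125 * t ^ 3 * (8575 / 8112) * hs4 - 32 * (8575 / 8112) ^ 2 * hs2
  rw [key]
  exact mul_nonpos_of_nonneg_of_nonpos (by positivity) (octic_cofactor_nonpos ht.le ht2)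

lemma quadratic_mul_le {A B C x y : ℝ} (hy : 0 ≤ y) (h : A + B * x - C * x ^ 2 ≤ 0) :
    (A + B * y - C * y ^ 2) * x ≤ (x - y) * (A + C * x * y) := by
  have := mul_nonneg hy (sub_nonneg.2 h)
  nlinarith

lemma Gamma1_quadratic (β : ℝ) :
    18 * β ^ 10 + (125 * β ^ 3 - 111 * β ^ 5) * Gamma1 β - 32 * Gamma1 β ^ 2 = 0 := by
  have h5 : √(5 : ℝ) ^ 2 = 5 := Real.sq_sqrt (by norm_num)
  have hD : √(117 * β ^ 4 - 222 * β ^ 2 + 125) ^ 2 = 117 * β ^ 4 - 222 * β ^ 2 + 125 :=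
    Real.sq_sqrt (by nlinarith [sq_nonneg (β ^ 2 - 111 / 117)])
  unfold Gamma1
  linear_combination (-(β ^ 6) * 25 / 128 * √(117 * β ^ 4 - 222 * β ^ 2 + 125) ^ 2) * h5 -
    β ^ 6 * 125 / 128 * hD

lemma Gamma1_argmax : Gamma1 √(35 / 39) = 8575 / 8112 * √(35 / 39) := by
  have hs2 : √(35 / 39 : ℝ) ^ 2 = 35 / 39 := Real.sq_sqrt (by norm_num)
  have hs4 : √(35 / 39 : ℝ) ^ 4 = (35 / 39) ^ 2 := by
    rw [show (4 : ℕ) = 2 * 2 from rfl, pow_mul, hs2]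
  have hs3 : √(35 / 39 : ℝ) ^ 3 = 35 / 39 * √(35 / 39) := by rw [pow_succ, hs2]
  have h : √(5 : ℝ) * √(117 * (35 / 39) ^ 2 - 222 * (35 / 39) + 125) = 10 := by
    rw [← Real.sqrt_mul (by norm_num), Real.sqrt_eq_iff_mul_self_eq] <;> norm_num
  unfold Gamma1
  rw [hs4, hs3, hs2]
  linear_combination (35 / 39 * √(35 / 39) * 5 / 64) * h

/-- For `β ∈ (0,1]` and `Γ ≥ (8575/8112)√(35/39)` one has
`18β¹⁰ + (125β³ − 111β⁵)Γ − 32Γ² ≤ 0`; moreover `Γ₁(β)` is a root of the quadratic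
and attains its maximum over `(0,1]` at `β = √(35/39)`, with value `(8575/8112)√(35/39)`. -/
theorem stmt_13 :
    (∀ β ∈ Set.Ioc (0:ℝ) 1, ∀ Γ : ℝ, 8575 / 8112 * Real.sqrt (35 / 39) ≤ Γ →
      18 * β ^ 10 + (125 * β ^ 3 - 111 * β ^ 5) * Γ - 32 * Γ ^ 2 ≤ 0) ∧
    (∀ β ∈ Set.Ioc (0:ℝ) 1,
      18 * β ^ 10 + (125 * β ^ 3 - 111 * β ^ 5) * Gamma1 β - 32 * Gamma1 β ^ 2 = 0 ∧
      Gamma1 β ≤ Gamma1 (Real.sqrt (35 / 39))) ∧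
    Gamma1 (Real.sqrt (35 / 39)) = 8575 / 8112 * Real.sqrt (35 / 39) := by
  have hG : 0 < 8575 / 8112 * √(35 / 39 : ℝ) := by positivity
  refine ⟨fun β hβ Γ hΓ => ?_, fun β hβ => ⟨Gamma1_quadratic β, ?_⟩, Gamma1_argmax⟩
  · have hA : 0 < 18 * β ^ 10 := by have := hβ.1; positivity
    have hΓ0 : 0 < Γ := hG.trans_le hΓ
    have h := quadratic_mul_le hΓ0.le (quadratic_at_max_nonpos hβ.1 hβ.2)
    refine nonpos_of_mul_nonpos_left (h.trans ?_) hG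
    exact mul_nonpos_of_nonpos_of_nonneg (sub_nonpos.2 hΓ) (by positivity)
  · rw [Gamma1_argmax]
    by_contra! hlt
    have hA : 0 < 18 * β ^ 10 := by have := hβ.1; positivity
    have hΓ0 : 0 < Gamma1 β := hG.trans hlt
    have h := quadratic_mul_le hΓ0.le (quadratic_at_max_nonpos hβ.1 hβ.2)
    rw [Gamma1_quadratic, zero_mul] at h
    exact h.not_gt (mul_neg_of_neg_of_pos (sub_neg.2 hlt) (by positivity))
end

section
/- Let n ≥ 1, let 0 < r₁ < r₂ < … < rₙ be real numbers, and let ρ₀ ≥ ρ₁ ≥ … ≥ ρ_{n−1} > 0 with ρₙ = 0 be the values of a piecewise constant non-increasing density (ρ(r) = ρ_{j−1} for r_{j−1} ≤ r < r_j, with r₀ = 0). Set χⱼ = ρⱼ − ρ_{j−1} ≤ 0 for j = 1,…,n, let ρ̄ⱼ be the mean density inside radius rⱼ defined by the recursion ρ̄ⱼ = ρ_{j−1} + (r_{j−1}³/rⱼ³)·(ρ̄_{j−1} − ρ_{j−1}) with ρ̄₀ = ρ₀, and let F(a,b) = min(a,b)⁵/5. Then for every u ∈ ℝⁿ: −(1/3)·Σ_{j=1}^n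 χⱼ·ρ̄ⱼ·rⱼ⁵·uⱼ² − Σ_{j=1}^n Σ_{k=1}^n χⱼ·χₖ·F(rⱼ,rₖ)·uⱼ·uₖ ≥ 0. -/
theorem cube_mul_meanDensity_sub_eq_sum (n : ℕ) (r ρv ρb : ℕ → ℝ) (hr0 : r 0 = 0)
    (hr : ∀ j : ℕ, 1 ≤ j → j ≤ n → r j ≠ 0)
    (hρb : ∀ j : ℕ, 1 ≤ j → j ≤ n →
      ρb j = ρv (j - 1) + (r (j - 1)) ^ 3 / (r j) ^ 3 * (ρb (j - 1) - ρv (j - 1)))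
    (j : ℕ) (hj : j ≤ n) :
    r j ^ 3 * (ρb j - ρv j) = ∑ i ∈ Finset.Ioc 0 j, (ρv (i - 1) - ρv i) * r i ^ 3 := by
  induction j with
  | zero => simp [hr0]
  | succ j ih =>
    have hne := hr (j + 1) (by omega) hj
    rw [Finset.sum_Ioc_succ_top (Nat.zero_le j), ← ih (by omega), hρb (j + 1) (by omega) hj]
    simp only [Nat.add_sub_cancel]
    field_simp
    ring

theorem sum_Ioc_pred_sub (f : ℕ → ℝ) {j n : ℕ} (hjn : j ≤ n) :
    ∑ i ∈ Finset.Ioc j n, (f (i - 1) - f i) = f j - f n := by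
  induction n, hjn using Nat.le_induction with
  | base => simp
  | succ n hn ih =>
    rw [Finset.sum_Ioc_succ_top hn, ih]
    simp

theorem cube_mul_meanDensity_eq_sum_min (n : ℕ) (r ρv ρb : ℕ → ℝ) (hr0 : r 0 = 0)
    (hr : ∀ j : ℕ, 1 ≤ j → j ≤ n → r j ≠ 0)
    (hmono : ∀ i j : ℕ, 1 ≤ i → i ≤ j → j ≤ n → r i ≤ r j)
    (hρn : ρv n = 0)
    (hρb : ∀ j : ℕ, 1 ≤ j → j ≤ n →
      ρb j = ρv (j - 1) + (r (j - 1)) ^ 3 / (r j) ^ 3 * (ρb (j - 1) - ρv (j - 1)))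
    (j : ℕ) (hj1 : 1 ≤ j) (hj : j ≤ n) :
    r j ^ 3 * ρb j = ∑ i ∈ Finset.Ioc 0 n, (ρv (i - 1) - ρv i) * min (r j) (r i) ^ 3 := by
  rw [← Finset.sum_Ioc_consecutive _ (Nat.zero_le j) hj]
  have h₁ : ∑ i ∈ Finset.Ioc 0 j, (ρv (i - 1) - ρv i) * min (r j) (r i) ^ 3 =
      ∑ i ∈ Finset.Ioc 0 j, (ρv (i - 1) - ρv i) * r i ^ 3 := by
    refine Finset.sum_congr rfl fun i hi => ?_
    rw [Finset.mem_Ioc] at hi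
    rw [min_eq_right (hmono i j hi.1 hi.2 hj)]
  have h₂ : ∑ i ∈ Finset.Ioc j n, (ρv (i - 1) - ρv i) * min (r j) (r i) ^ 3 =
      ∑ i ∈ Finset.Ioc j n, (ρv (i - 1) - ρv i) * r j ^ 3 := by
    refine Finset.sum_congr rfl fun i hi => ?_
    rw [Finset.mem_Ioc] at hi
    rw [min_eq_left (hmono j i hj1 hi.1.le hi.2)]
  rw [h₁, h₂, ← Finset.sum_mul, sum_Ioc_pred_sub ρv hj, hρn,
    ← cube_mul_meanDensity_sub_eq_sum n r ρv ρb hr0 hr hρb j hj]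
  ring

theorem min_pow_five_mul_le {a b : ℝ} (ha : 0 ≤ a) (hb : 0 ≤ b) (x y : ℝ) :
    min a b ^ 5 / 5 * x * y ≤ min a b ^ 3 * (a ^ 2 * x ^ 2 + b ^ 2 * y ^ 2) / 6 := by
  have hm : 0 ≤ min a b := le_min ha hb
  have hxa : min a b ^ 2 * x ^ 2 ≤ a ^ 2 * x ^ 2 := by gcongr; exact min_le_left a b
  have hyb : min a b ^ 2 * y ^ 2 ≤ b ^ 2 * y ^ 2 := by gcongr; exact min_le_right a b
  have hxy : x * y / 5 ≤ (x ^ 2 + y ^ 2) / 6 := by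
    nlinarith [sq_nonneg (x - y), sq_nonneg (x + y)]
  calc min a b ^ 5 / 5 * x * y = min a b ^ 5 * (x * y / 5) := by ring
    _ ≤ min a b ^ 5 * ((x ^ 2 + y ^ 2) / 6) := by gcongr
    _ = min a b ^ 3 * (min a b ^ 2 * x ^ 2 + min a b ^ 2 * y ^ 2) / 6 := by ring
    _ ≤ min a b ^ 3 * (a ^ 2 * x ^ 2 + b ^ 2 * y ^ 2) / 6 := by gcongr

/-- For a piecewise constant non-increasing density with jump values
`χⱼ = ρⱼ − ρ_{j−1} ≤ 0` at radii `0 < r₁ < … < rₙ`, mean densities `ρ̄ⱼ` given by the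
stated recursion, and `F(a,b) = min(a,b)⁵/5`, the quadratic form
`−(1/3)Σ χⱼρ̄ⱼrⱼ⁵uⱼ² − ΣΣ χⱼχₖF(rⱼ,rₖ)uⱼuₖ` is non-negative for every `u ∈ ℝⁿ`. -/
theorem stmt_15 (n : ℕ) (hn : 1 ≤ n) (r ρv : ℕ → ℝ)
    (hr0 : r 0 = 0)
    (hr1 : 0 < r 1)
    (hrmono : ∀ j : ℕ, 1 ≤ j → j < n → r j < r (j + 1))
    (hρpos : ∀ j : ℕ, j < n → 0 < ρv j)
    (hρmono : ∀ j : ℕ, j + 1 < n → ρv (j + 1) ≤ ρv j)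
    (hρn : ρv n = 0)
    (χ : ℕ → ℝ) (hχ : ∀ j : ℕ, 1 ≤ j → j ≤ n → χ j = ρv j - ρv (j - 1))
    (ρb : ℕ → ℝ) (hρb0 : ρb 0 = ρv 0)
    (hρb : ∀ j : ℕ, 1 ≤ j → j ≤ n →
      ρb j = ρv (j - 1) + (r (j - 1)) ^ 3 / (r j) ^ 3 * (ρb (j - 1) - ρv (j - 1)))
    (u : ℕ → ℝ) :
    0 ≤ -(1 / 3) * ∑ j ∈ Finset.Icc 1 n, χ j * ρb j * (r j) ^ 5 * (u j) ^ 2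
        - ∑ j ∈ Finset.Icc 1 n, ∑ k ∈ Finset.Icc 1 n,
            χ j * χ k * (min (r j) (r k) ^ 5 / 5) * u j * u k := by
  have hmono : ∀ i j : ℕ, 1 ≤ i → i ≤ j → j ≤ n → r i ≤ r j := by
    intro i j hi hij
    induction j, hij using Nat.le_induction with
    | base => exact fun _ => le_rfl
    | succ j hij ih =>
      exact fun hj => (ih (by omega)).trans (hrmono j (by omega) (by omega)).le
  have hrpos : ∀ j : ℕ, 1 ≤ j → j ≤ n → 0 < r j := fun j h₁ h₂ =>
    hr1.trans_le (hmono 1 j le_rfl h₁ h₂)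
  have hmass := cube_mul_meanDensity_eq_sum_min n r ρv ρb hr0
    (fun j h₁ h₂ => (hrpos j h₁ h₂).ne') hmono hρn hρb
  have hIcc : Finset.Icc 1 n = Finset.Ioc 0 n := rfl
  have hχ_nonpos : ∀ j ∈ Finset.Icc 1 n, χ j ≤ 0 := by
    intro j hj
    rw [Finset.mem_Icc] at hj
    rw [hχ j hj.1 hj.2]
    obtain ⟨k, rfl⟩ : ∃ k, j = k + 1 := ⟨j - 1, by omega⟩
    rw [Nat.add_sub_cancel]
    rcases hj.2.eq_or_lt with h | h
    · linarith [hρpos k (by omega), h ▸ hρn]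
    · linarith [hρmono k h]
  set D := ∑ j ∈ Finset.Icc 1 n, ∑ k ∈ Finset.Icc 1 n,
    χ j * χ k * (min (r j) (r k) ^ 3 * (r j ^ 2 * u j ^ 2)) with hD
  have hdiag : ∑ j ∈ Finset.Icc 1 n, χ j * ρb j * (r j) ^ 5 * (u j) ^ 2 = -D := by
    rw [hD, ← Finset.sum_neg_distrib]
    refine Finset.sum_congr rfl fun j hj => ?_
    rw [Finset.mem_Icc] at hj
    calc χ j * ρb j * r j ^ 5 * u j ^ 2
        = χ j * r j ^ 2 * u j ^ 2 * (r j ^ 3 * ρb j) := by ring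
      _ = _ := by
        rw [hmass j hj.1 hj.2, hIcc, Finset.mul_sum, ← Finset.sum_neg_distrib]
        refine Finset.sum_congr rfl fun i hi => ?_
        rw [Finset.mem_Ioc] at hi
        rw [hχ i hi.1 hi.2]
        ring
  have hswap : D = ∑ j ∈ Finset.Icc 1 n, ∑ k ∈ Finset.Icc 1 n,
      χ j * χ k * (min (r j) (r k) ^ 3 * (r k ^ 2 * u k ^ 2)) := by
    rw [hD, Finset.sum_comm]
    refine Finset.sum_congr rfl fun j _ => Finset.sum_congr rfl fun k _ => ?_
    rw [min_comm, mul_comm (χ k)]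
  have hsym : D / 3 = ∑ j ∈ Finset.Icc 1 n, ∑ k ∈ Finset.Icc 1 n,
      χ j * χ k * (min (r j) (r k) ^ 3 * (r j ^ 2 * u j ^ 2 + r k ^ 2 * u k ^ 2) / 6) := by
    calc D / 3 = (D + D) / 6 := by ring
      _ = _ := by
        nth_rewrite 2 [hswap]
        simp only [hD, ← Finset.sum_add_distrib, Finset.sum_div]
        refine Finset.sum_congr rfl fun j _ => Finset.sum_congr rfl fun k _ => ?_
        ring
  have hle : ∑ j ∈ Finset.Icc 1 n, ∑ k ∈ Finset.Icc 1 n,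
      χ j * χ k * (min (r j) (r k) ^ 5 / 5) * u j * u k ≤ D / 3 := by
    rw [hsym]
    refine Finset.sum_le_sum fun j hj => Finset.sum_le_sum fun k hk => ?_
    have hχχ := mul_nonneg_of_nonpos_of_nonpos (hχ_nonpos j hj) (hχ_nonpos k hk)
    rw [Finset.mem_Icc] at hj hk
    have h := mul_le_mul_of_nonneg_left
      (min_pow_five_mul_le (hrpos j hj.1 hj.2).le (hrpos k hk.1 hk.2).le (u j) (u k)) hχχ
    linarith
  rw [hdiag]
  linarith
end

section
/- Let R > 0, let ρ : ℝ → [0,∞) be even, non-increasing on [0,∞), with ρ(r) = 0 for |r| ≥ R, and let f : ℝ → ℝ be a C^∞ even function with support contained in [−1,1], f > 0 on (−1,1), ∫_ℝ f(r) dr = 1, and f′(r) < 0 for 0 < r < 1. For ζ > 0 define g_ζ(r) = ζ·(R − |r|) for |r| ≤ R and g_ζ(r) = 0 for |r| > R, and the regularized density ρ_ζ(r) = (1/ζ)·∫_ℝ f((r − a)/ζ)·[ρ(a) + g_ζ(a)] da. Then ρ_ζ is C^∞, positive on (−R−ζ, R+ζ), even, and satisfies ρ_ζ′(r) < 0 for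 0 < r < R + ζ. -/
open MeasureTheory Set Real

open scoped Convolution

section Unimodal

variable {R : ℝ} {h : ℝ → ℝ}

/-- A function that is even, vanishes outside `(-R, R)` and strictly decreases in `|x|` inside,
is weakly decreasing in `|x|` everywhere. -/
lemma le_of_abs_le_of_strict (heven : ∀ x, h (-x) = h x) (hzero : ∀ x, R ≤ |x| → h x = 0)
    (hstrict : ∀ x y, |x| < R → |x| < |y| → h y < h x) {x y : ℝ} (hxy : |x| ≤ |y|) :
    h y ≤ h x := by
  rcases lt_or_ge |x| R with hx | hx
  · rcases hxy.lt_or_eq with hlt | heq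
    · exact (hstrict x y hx hlt).le
    · rcases abs_eq_abs.1 heq with rfl | rfl
      · exact le_rfl
      · exact (heven y).ge
  · rw [hzero x hx, hzero y (hx.trans hxy)]

lemma pos_of_abs_lt_of_strict (hzero : ∀ x, R ≤ |x| → h x = 0)
    (hstrict : ∀ x y, |x| < R → |x| < |y| → h y < h x) {x : ℝ} (hx : |x| < R) :
    0 < h x := by
  have h1 := hstrict x R hx (hx.trans_le (le_abs_self R))
  rwa [hzero R (le_abs_self R)] at h1

lemma nonneg_of_strict (hzero : ∀ x, R ≤ |x| → h x = 0)
    (hstrict : ∀ x y, |x| < R → |x| < |y| → h y < h x) (x : ℝ) : 0 ≤ h x := by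
  rcases lt_or_ge |x| R with hx | hx
  · exact (pos_of_abs_lt_of_strict hzero hstrict hx).le
  · exact (hzero x hx).ge

lemma integrable_of_strict (heven : ∀ x, h (-x) = h x) (hzero : ∀ x, R ≤ |x| → h x = 0)
    (hstrict : ∀ x y, |x| < R → |x| < |y| → h y < h x) : Integrable h := by
  have hle {x y : ℝ} (hxy : |x| ≤ |y|) : h y ≤ h x :=
    le_of_abs_le_of_strict heven hzero hstrict hxy
  have hanti : Antitone fun x => h (max x 0) := fun x y hxy => by
    apply hle
    rw [abs_of_nonneg (le_max_right x 0), abs_of_nonneg (le_max_right y 0)]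
    exact max_le_max_right 0 hxy
  have heq : h = fun x => h (max |x| 0) := by
    funext x
    rw [max_eq_left (abs_nonneg x)]
    exact le_antisymm (hle (abs_abs x).le) (hle (abs_abs x).ge)
  have hmeas : Measurable h := by
    rw [heq]
    exact hanti.measurable.comp measurable_norm
  have hsupp : Function.support h ⊆ Icc (-R) R := fun x hx => by
    rw [Set.mem_Icc, ← abs_le]
    by_contra hc
    exact hx (hzero x (not_le.1 hc).le)
  rw [← integrableOn_iff_integrable_of_support_subset hsupp]
  refine Measure.integrableOn_of_bounded (M := h 0) (by simp) hmeas.aestronglyMeasurable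
    (Filter.Eventually.of_forall fun x => ?_)
  rw [Real.norm_of_nonneg (nonneg_of_strict hzero hstrict x)]
  exact hle (by simp)

end Unimodal

lemma integral_pos_of_nonneg_of_pos_on_Ioo {F : ℝ → ℝ} {a b : ℝ} (hF : Integrable F)
    (hnn : ∀ x, 0 ≤ F x) (hab : a < b) (hpos : ∀ x ∈ Ioo a b, 0 < F x) : 0 < ∫ x, F x := by
  rw [integral_pos_iff_support_of_nonneg hnn hF]
  refine lt_of_lt_of_le ?_ (measure_mono fun x hx => (hpos x hx).ne')
  simpa using hab

section Mollifier

variable {R ζ : ℝ} {h φ : ℝ → ℝ}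

lemma hasCompactSupport_of_zero (hφzero : ∀ x, ζ ≤ |x| → φ x = 0) : HasCompactSupport φ :=
  HasCompactSupport.intro (isCompact_Icc (a := -ζ) (b := ζ)) fun x hx =>
    hφzero x (by rw [Set.mem_Icc, ← abs_le] at hx; exact (not_le.1 hx).le)

lemma integrable_mul_comp_sub_left (hh : Integrable h) (hφ : Continuous φ)
    (hφc : HasCompactSupport φ) (r : ℝ) : Integrable fun a => h a * φ (r - a) := by
  obtain ⟨C, hC⟩ := hφc.exists_bound_of_continuous hφ
  exact hh.mul_bdd (hφ.comp (continuous_const.sub continuous_id)).aestronglyMeasurable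
    (Filter.Eventually.of_forall fun a => hC (r - a))

lemma integral_mul_comp_sub_left_pos (hR : 0 < R) (hζ : 0 < ζ) (hzero : ∀ x, R ≤ |x| → h x = 0)
    (hstrict : ∀ x y, |x| < R → |x| < |y| → h y < h x) (hh : Integrable h) (hφ : Continuous φ)
    (hφzero : ∀ x, ζ ≤ |x| → φ x = 0) (hφpos : ∀ x, |x| < ζ → 0 < φ x) {r : ℝ}
    (hr : |r| < R + ζ) : 0 < ∫ a, h a * φ (r - a) := by
  have hφnn (x : ℝ) : 0 ≤ φ x := by
    rcases lt_or_ge |x| ζ with hx | hx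
    · exact (hφpos x hx).le
    · exact (hφzero x hx).ge
  obtain ⟨hr1, hr2⟩ := abs_lt.1 hr
  refine integral_pos_of_nonneg_of_pos_on_Ioo (a := max (-R) (r - ζ)) (b := min R (r + ζ))
    (integrable_mul_comp_sub_left hh hφ (hasCompactSupport_of_zero hφzero) r)
    (fun a => mul_nonneg (nonneg_of_strict hzero hstrict a) (hφnn _)) ?_ fun a ha => ?_
  · simp only [max_lt_iff, lt_min_iff]
    refine ⟨⟨?_, ?_⟩, ?_, ?_⟩ <;> linarith
  · simp only [mem_Ioo, max_lt_iff, lt_min_iff] at ha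
    exact mul_pos (pos_of_abs_lt_of_strict hzero hstrict (abs_lt.2 ⟨ha.1.1, ha.2.1⟩))
      (hφpos _ (abs_lt.2 ⟨by linarith, by linarith⟩))

lemma integral_mul_comp_sub_left_even (heven : ∀ x, h (-x) = h x) (hφeven : ∀ x, φ (-x) = φ x)
    (r : ℝ) : ∫ a, h a * φ (-r - a) = ∫ a, h a * φ (r - a) := by
  rw [← integral_neg_eq_self]
  refine integral_congr_ae (Filter.Eventually.of_forall fun a => ?_)
  simp only [heven]
  rw [← hφeven (r - a)]
  ring_nf

/-- Convolving a symmetric strictly unimodal function with an odd kernel that is negative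
on `(0, ζ)` gives a negative value on `(0, R + ζ)`. -/
lemma integral_mul_odd_comp_sub_left_neg (hR : 0 < R) (hζ : 0 < ζ) (heven : ∀ x, h (-x) = h x)
    (hzero : ∀ x, R ≤ |x| → h x = 0)
    (hstrict : ∀ x y, |x| < R → |x| < |y| → h y < h x) (hh : Integrable h)
    {ψ : ℝ → ℝ} (hψ : Continuous ψ) (hψodd : ∀ x, ψ (-x) = -ψ x)
    (hψzero : ∀ x, ζ ≤ |x| → ψ x = 0) (hψneg : ∀ x, 0 < x → x < ζ → ψ x < 0) {r : ℝ}
    (hr0 : 0 < r) (hr : r < R + ζ) : ∫ a, h a * ψ (r - a) < 0 := by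
  have hint := integrable_mul_comp_sub_left hh hψ (hasCompactSupport_of_zero hψzero) r
  have hint1 : Integrable fun t => h (r - t) * ψ t := by
    simpa using hint.comp_sub_left r
  have hint2 : Integrable fun t => h (r + t) * ψ t := by
    simpa [hψodd] using hint1.comp_neg
  have e1 : ∫ a, h a * ψ (r - a) = ∫ t, h (r - t) * ψ t := by
    rw [← integral_sub_left_eq_self _ volume r]
    simp
  have e2 : ∫ t, h (r - t) * ψ t = -∫ t, h (r + t) * ψ t := by
    rw [← integral_neg_eq_self, ← integral_neg]
    simp [hψodd]
  have e3 : ∫ t, (h (r + t) * ψ t - h (r - t) * ψ t) = -2 * ∫ a, h a * ψ (r - a) := by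
    rw [integral_sub hint2 hint1, e1]
    linarith
  have hψ0 : ψ 0 = 0 := by
    have := hψodd 0
    rw [neg_zero] at this
    linarith
  have hψle (t : ℝ) (ht : 0 ≤ t) : ψ t ≤ 0 := by
    rcases ht.eq_or_lt with rfl | ht
    · exact hψ0.le
    rcases lt_or_ge t ζ with h1 | h1
    · exact (hψneg t ht h1).le
    · exact (hψzero t (h1.trans (le_abs_self t))).le
  have habs (t : ℝ) (ht : 0 ≤ t) : |r - t| ≤ |r + t| := by
    rw [abs_of_nonneg (by linarith : 0 ≤ r + t), abs_le]
    constructor <;> linarith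
  have hnn (t : ℝ) (ht : 0 ≤ t) : 0 ≤ h (r + t) * ψ t - h (r - t) * ψ t := by
    rw [← sub_mul]
    exact mul_nonneg_of_nonpos_of_nonpos
      (sub_nonpos.2 (le_of_abs_le_of_strict heven hzero hstrict (habs t ht))) (hψle t ht)
  have hpos : 0 < ∫ t, (h (r + t) * ψ t - h (r - t) * ψ t) := by
    refine integral_pos_of_nonneg_of_pos_on_Ioo (a := max 0 (r - R)) (b := min ζ (r + R))
      (hint2.sub hint1) (fun t => ?_) ?_ fun t ht => ?_
    · rcases le_total 0 t with ht | ht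
      · exact hnn t ht
      · have := hnn (-t) (by linarith)
        rw [hψodd, sub_neg_eq_add, ← sub_eq_add_neg] at this
        linarith
    · simp only [max_lt_iff, lt_min_iff]
      refine ⟨⟨?_, ?_⟩, ?_, ?_⟩ <;> linarith
    · simp only [mem_Ioo, max_lt_iff, lt_min_iff] at ht
      obtain ⟨⟨ht0, ht1⟩, ht2, ht3⟩ := ht
      rw [← sub_mul]
      refine mul_pos_of_neg_of_neg (sub_neg.2 (hstrict _ _ ?_ ?_)) (hψneg t ht0 ht2)
      · exact abs_lt.2 ⟨by linarith, by linarith⟩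
      · rw [abs_of_pos (by linarith : 0 < r + t), abs_lt]
        constructor <;> linarith
  linarith

end Mollifier

lemma deriv_neg_eq_neg_deriv_of_even {φ : ℝ → ℝ} (hφeven : ∀ x, φ (-x) = φ x) (x : ℝ) :
    deriv φ (-x) = -deriv φ x := by
  have h1 := deriv_comp_neg φ x
  simp only [hφeven] at h1
  linarith

lemma deriv_eq_zero_of_nonneg_of_eq_zero {φ : ℝ → ℝ} (hφ : ∀ x, 0 ≤ φ x) {x : ℝ}
    (hx : φ x = 0) : deriv φ x = 0 :=
  IsLocalMin.deriv_eq_zero (Filter.Eventually.of_forall fun y => hx.trans_le (hφ y))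

/-- Mollification of an even, non-increasing (on `[0,∞)`) density `ρ`
supported in `[−R,R]`, shifted by `g_ζ(r) = ζ(R − |r|)` and convolved with a strictly
unimodal mollifier `f`, yields a `C^∞`, even, positive regularized density `ρ_ζ` with
`ρ_ζ′(r) < 0` for `0 < r < R + ζ`. -/
theorem stmt_16 (R ζ : ℝ) (hR : 0 < R) (hζ : 0 < ζ)
    (ρ : ℝ → ℝ) (hρnn : ∀ r : ℝ, 0 ≤ ρ r) (hρeven : ∀ r : ℝ, ρ (-r) = ρ r)
    (hρmono : AntitoneOn ρ (Ici 0)) (hρzero : ∀ r : ℝ, R ≤ |r| → ρ r = 0)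
    (f : ℝ → ℝ) (hf : ContDiff ℝ (⊤ : ℕ∞) f) (hfeven : ∀ r : ℝ, f (-r) = f r)
    (hfsupp : ∀ r : ℝ, 1 ≤ |r| → f r = 0) (hfpos : ∀ r : ℝ, |r| < 1 → 0 < f r)
    (hfint : ∫ r : ℝ, f r = 1) (hfder : ∀ r : ℝ, 0 < r → r < 1 → deriv f r < 0)
    (g ρζ : ℝ → ℝ)
    (hg : ∀ r : ℝ, g r = if |r| ≤ R then ζ * (R - |r|) else 0)
    (hρζ : ∀ r : ℝ, ρζ r = (1 / ζ) * ∫ a : ℝ, f ((r - a) / ζ) * (ρ a + g a)) :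
    ContDiff ℝ (⊤ : ℕ∞) ρζ ∧
    (∀ r : ℝ, |r| < R + ζ → 0 < ρζ r) ∧
    (∀ r : ℝ, ρζ (-r) = ρζ r) ∧
    (∀ r : ℝ, 0 < r → r < R + ζ → deriv ρζ r < 0) := by
  set h : ℝ → ℝ := fun a => ρ a + g a with hh_def
  set φ : ℝ → ℝ := fun x => f (x / ζ) with hφ_def
  have hgeven (x : ℝ) : g (-x) = g x := by simp only [hg, abs_neg]
  have heven (x : ℝ) : h (-x) = h x := by simp only [hh_def, hρeven, hgeven]
  have hzero (x : ℝ) (hx : R ≤ |x|) : h x = 0 := by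
    simp only [hh_def, hρzero x hx, hg, zero_add]
    split_ifs with hle
    · rw [le_antisymm hle hx, sub_self, mul_zero]
    · rfl
  have hρabs (x : ℝ) : ρ |x| = ρ x := by
    rcases abs_choice x with h1 | h1 <;> rw [h1]
    exact hρeven x
  have hstrict (x y : ℝ) (hx : |x| < R) (hxy : |x| < |y|) : h y < h x := by
    have h1 : ρ y ≤ ρ x := by
      rw [← hρabs x, ← hρabs y]
      exact hρmono (abs_nonneg x) (abs_nonneg y) hxy.le
    have h2 : g y < g x := by
      rw [hg, hg, if_pos hx.le]
      split_ifs
      · exact mul_lt_mul_of_pos_left (by linarith) hζ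
      · exact mul_pos hζ (by linarith)
    exact add_lt_add_of_le_of_lt h1 h2
  have hhint : Integrable h := integrable_of_strict heven hzero hstrict
  have hφsmooth : ContDiff ℝ (⊤ : ℕ∞) φ := hf.comp (contDiff_id.div_const ζ)
  have hφeven (x : ℝ) : φ (-x) = φ x := by simp only [hφ_def, neg_div, hfeven]
  have habs (x : ℝ) : |x / ζ| = |x| / ζ := by rw [abs_div, abs_of_pos hζ]
  have hφzero (x : ℝ) (hx : ζ ≤ |x|) : φ x = 0 :=
    hfsupp _ (by rwa [habs, one_le_div hζ])
  have hφpos (x : ℝ) (hx : |x| < ζ) : 0 < φ x :=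
    hfpos _ (by rwa [habs, div_lt_one hζ])
  have hφnn (x : ℝ) : 0 ≤ φ x := by
    rcases lt_or_ge |x| ζ with hx | hx
    · exact (hφpos x hx).le
    · exact (hφzero x hx).ge
  have hφc : HasCompactSupport φ := hasCompactSupport_of_zero hφzero
  have hφneg (x : ℝ) (hx : 0 < x) (hxζ : x < ζ) : deriv φ x < 0 := by
    have hfd : HasDerivAt f (deriv f (x / ζ)) (x / ζ) :=
      (hf.differentiable (by simp) _).hasDerivAt
    have hd : HasDerivAt φ (deriv f (x / ζ) * (1 / ζ)) x :=
      hfd.comp x ((hasDerivAt_id x).div_const ζ)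
    rw [hd.deriv]
    exact mul_neg_of_neg_of_pos (hfder _ (div_pos hx hζ) ((div_lt_one hζ).2 hxζ))
      (one_div_pos.2 hζ)
  have hφ1 : ContDiff ℝ 1 φ := hφsmooth.of_le (by exact_mod_cast le_top)
  have hρζ' (r : ℝ) : ρζ r = (1 / ζ) * ∫ a, h a * φ (r - a) := by
    simp only [hρζ, hh_def, hφ_def, mul_comm]
  have hconv : ρζ = fun r => (1 / ζ) * (h ⋆[ContinuousLinearMap.mul ℝ ℝ] φ) r := by
    funext r
    rw [hρζ', convolution_def]
    rfl
  refine ⟨?_, fun r hr => ?_, fun r => ?_, fun r hr0 hr => ?_⟩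
  · rw [hconv]
    exact contDiff_const.mul (hφc.contDiff_convolution_right _ hhint.locallyIntegrable hφsmooth)
  · rw [hρζ']
    exact mul_pos (one_div_pos.2 hζ) (integral_mul_comp_sub_left_pos hR hζ hzero hstrict hhint
      hφsmooth.continuous hφzero hφpos hr)
  · rw [hρζ', hρζ', integral_mul_comp_sub_left_even heven hφeven]
  · have hder := ((hφc.hasDerivAt_convolution_right (ContinuousLinearMap.mul ℝ ℝ)
      hhint.locallyIntegrable hφ1 r).const_mul (1 / ζ)).deriv
    rw [hconv, hder, convolution_def]
    exact mul_neg_of_pos_of_neg (one_div_pos.2 hζ) (integral_mul_odd_comp_sub_left_neg hR hζ heven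
      hzero hstrict hhint (hφ1.continuous_deriv le_rfl) (deriv_neg_eq_neg_deriv_of_even hφeven)
      (fun x hx => deriv_eq_zero_of_nonneg_of_eq_zero hφnn (hφzero x hx)) hφneg hr0 hr)
end

section
/- Define g : (1/√3, 1] → ℝ by g(x) = (3/2)·x⁵·( 1 + (5/2 − (3/2)x²)² ) / ( 4 − (5/2 − (3/2)x²)² ). Then g(1) = 1, g′(1) = 0, and g″(1) = 0; consequently there exist constants C > 0 and δ₀ > 0 such that |g(1 − δ) − 1| ≤ C·δ³ for all 0 ≤ δ ≤ δ₀. -/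
/-- The Darwin–Radau approximation for the normalized gravitational rigidity modulus
`γ/γ_I` as a function of `x = R_I/R`. -/
noncomputable def gDR (x : ℝ) : ℝ :=
  (3 / 2) * x ^ 5 * (1 + (5 / 2 - (3 / 2) * x ^ 2) ^ 2) /
    (4 - (5 / 2 - (3 / 2) * x ^ 2) ^ 2)

open Filter Topology

/-- A function of the form `c + (x - a) ^ 3 * h x` near `a`, with `h` of class `C²` at `a`, has
vanishing first and second derivatives at `a`. -/
lemma deriv_eq_zero_of_eventuallyEq_add_pow_three_mul {f h : ℝ → ℝ} {a c : ℝ}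
    (hf : f =ᶠ[𝓝 a] fun x => c + (x - a) ^ 3 * h x) (hh : ContDiffAt ℝ 2 h a) :
    deriv f a = 0 ∧ deriv (deriv f) a = 0 := by
  have hdiff : ∀ᶠ x in 𝓝 a, DifferentiableAt ℝ h x :=
    (hh.eventually (by simp)).mono fun x hx => hx.differentiableAt (by simp)
  have hdh : DifferentiableAt ℝ (deriv h) a :=
    (hh.derivWithin (m := 1) (by norm_num)).differentiableAt (by simp)
  have hderiv : deriv f =ᶠ[𝓝 a] fun x => (x - a) ^ 2 * (3 * h x + (x - a) * deriv h x) := by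
    filter_upwards [hf.deriv, hdiff] with x hfx hhx
    rw [hfx]
    have key := ((((hasDerivAt_id x).sub_const a).pow 3).mul hhx.hasDerivAt).const_add c
    refine (key.congr_deriv ?_).deriv
    simp
    ring
  refine ⟨by simpa using hderiv.eq_of_nhds, ?_⟩
  rw [hderiv.deriv_eq]
  have hk : DifferentiableAt ℝ (fun x => 3 * h x + (x - a) * deriv h x) a :=
    (hdiff.self_of_nhds.const_mul 3).add ((differentiableAt_id.sub_const a).mul hdh)
  refine (((((hasDerivAt_id a).sub_const a).pow 2).mul hk.hasDerivAt).congr_deriv ?_).deriv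
  simp

/-- A function of the form `c + (x - a) ^ 3 * h x` near `a`, with `h` continuous at `a`, differs
from `c` by at most a cubic error to the left of `a`. -/
lemma exists_abs_sub_le_mul_pow_three {f h : ℝ → ℝ} {a c : ℝ}
    (hf : f =ᶠ[𝓝 a] fun x => c + (x - a) ^ 3 * h x) (hh : ContinuousAt h a) :
    ∃ C : ℝ, 0 < C ∧ ∃ δ₀ : ℝ, 0 < δ₀ ∧
      ∀ δ : ℝ, 0 ≤ δ → δ ≤ δ₀ → |f (a - δ) - c| ≤ C * δ ^ 3 := by
  have hbound : ∀ᶠ x in 𝓝 a, |h x| < |h a| + 1 :=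
    hh.abs.eventually_lt_const (lt_add_one _)
  obtain ⟨ε, hε, hball⟩ := Metric.eventually_nhds_iff.mp (hf.and hbound)
  refine ⟨|h a| + 1, by positivity, ε / 2, by positivity, fun δ hδ hδε => ?_⟩
  obtain ⟨hfδ, hhδ⟩ := hball (y := a - δ) (by
    rw [Real.dist_eq, sub_sub_cancel_left, abs_neg, abs_of_nonneg hδ]
    linarith)
  rw [hfδ, add_sub_cancel_left, abs_mul, abs_pow, sub_sub_cancel_left, abs_neg,
    abs_of_nonneg hδ, mul_comm]
  gcongr

/-- The quotient of `gDR x - 1` by `(x - 1) ^ 3`. -/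
noncomputable def gDRCubicQuotient (x : ℝ) : ℝ :=
  (3 / 8) * (9 * x ^ 6 + 27 * x ^ 5 + 24 * x ^ 4 - 16 * x ^ 2 - 18 * x - 6) /
    (4 - (5 / 2 - (3 / 2) * x ^ 2) ^ 2)

lemma contDiffAt_gDRCubicQuotient : ContDiffAt ℝ 2 gDRCubicQuotient 1 := by
  unfold gDRCubicQuotient
  exact ContDiffAt.div (by fun_prop) (by fun_prop) (by norm_num)

lemma gDR_eventuallyEq :
    gDR =ᶠ[𝓝 1] fun x => 1 + (x - 1) ^ 3 * gDRCubicQuotient x := by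
  have hcont : ContinuousAt (fun x : ℝ => 4 - (5 / 2 - (3 / 2) * x ^ 2) ^ 2) 1 := by fun_prop
  filter_upwards [hcont.eventually_ne (by norm_num : _ ≠ (0 : ℝ))] with x hx
  rw [gDR, gDRCubicQuotient, mul_div_assoc', div_eq_iff hx, add_mul, div_mul_cancel₀ _ hx]
  ring

/-- `gDR 1 = 1`, `gDR′(1) = 0`, `gDR″(1) = 0`; consequently
`|gDR(1 − δ) − 1| ≤ C δ³` for small `δ ≥ 0`. -/
theorem stmt_17 :
    gDR 1 = 1 ∧ deriv gDR 1 = 0 ∧ deriv (deriv gDR) 1 = 0 ∧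
    ∃ C : ℝ, 0 < C ∧ ∃ δ₀ : ℝ, 0 < δ₀ ∧
      ∀ δ : ℝ, 0 ≤ δ → δ ≤ δ₀ → |gDR (1 - δ) - 1| ≤ C * δ ^ 3 := by
  obtain ⟨h₁, h₂⟩ := deriv_eq_zero_of_eventuallyEq_add_pow_three_mul gDR_eventuallyEq
    contDiffAt_gDRCubicQuotient
  exact ⟨by norm_num [gDR], h₁, h₂, exists_abs_sub_le_mul_pow_three gDR_eventuallyEq
    contDiffAt_gDRCubicQuotient.continuousAt⟩
end

section
/- Fix k ∈ (0,1). For x ∈ (0,k] define α(x) = (k²x³ − x⁵)/(k²x³ − x⁵ + 1 − k²) and h(x) = (1/2)·( (x⁵ + α(x)(1 − x⁵))/(x³ + α(x)(1 − x³)) )^{5/2} · ( 3α(x)²(3x⁵ − 5x³ + 2) + α(x)(−9x⁵ + 5x³ + 4) + 10x³ ) / ( α(x)²(5x⁸ − 8x⁵ + 3) + α(x)(−10x⁸ + 8x⁵ + 2) + 5x⁸ ). Then lim_{x→0⁺} h(x) = (1/2)·k³·(5 − 3k²). Moreover α(x) = (k²/(1 − k²))·x³ + O(x⁵) as x → 0⁺.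 -/
open Filter Asymptotics Set

/-- **thick shell Roche limit.** For fixed `k ∈ (0,1)`, the normalized
gravitational rigidity modulus `h(x)` of a two-layer body with inner radius fraction `x`
and density ratio `α(x)` chosen so that `R_I/R = k` satisfies
`h(x) → (1/2)k³(5 − 3k²)` as `x → 0⁺`, and `α(x) = (k²/(1 − k²))x³ + O(x⁵)`. -/
theorem stmt_18 (k : ℝ) (hk : k ∈ Ioo (0:ℝ) 1)
    (α h : ℝ → ℝ)
    (hα : ∀ x : ℝ, α x = (k ^ 2 * x ^ 3 - x ^ 5) / (k ^ 2 * x ^ 3 - x ^ 5 + 1 - k ^ 2))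
    (hh : ∀ x : ℝ, h x =
      (1 / 2) * ((x ^ 5 + α x * (1 - x ^ 5)) / (x ^ 3 + α x * (1 - x ^ 3))) ^ ((5 : ℝ) / 2)
        * (3 * α x ^ 2 * (3 * x ^ 5 - 5 * x ^ 3 + 2)
            + α x * (-9 * x ^ 5 + 5 * x ^ 3 + 4) + 10 * x ^ 3)
        / (α x ^ 2 * (5 * x ^ 8 - 8 * x ^ 5 + 3)
            + α x * (-10 * x ^ 8 + 8 * x ^ 5 + 2) + 5 * x ^ 8)) :
    Tendsto h (nhdsWithin 0 (Ioi 0)) (nhds ((1 / 2) * k ^ 3 * (5 - 3 * k ^ 2))) ∧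
    (fun x : ℝ => α x - k ^ 2 / (1 - k ^ 2) * x ^ 3) =O[nhdsWithin 0 (Ioi 0)]
      fun x : ℝ => x ^ 5 := by
  obtain ⟨hk0, hk1⟩ := hk
  have hk2 : 0 < 1 - k ^ 2 := by nlinarith
  set D : ℝ → ℝ := fun x => k ^ 2 * x ^ 3 - x ^ 5 + 1 - k ^ 2 with hD
  have hDc : ContinuousAt D 0 := by fun_prop
  have hD0 : D 0 = 1 - k ^ 2 := by simp [hD]
  have hDne : D 0 ≠ 0 := hD0 ▸ hk2.ne'
  set b : ℝ → ℝ := fun x => (k ^ 2 - x ^ 2) / D x with hb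
  have hbc : ContinuousAt b 0 := ContinuousAt.div (by fun_prop) hDc hDne
  have hb0 : b 0 = k ^ 2 / (1 - k ^ 2) := by simp [hb, hD0]
  have hbpos : 0 < b 0 := by rw [hb0]; positivity
  have hαb (x : ℝ) : α x = x ^ 3 * b x := by
    rw [hα]
    simp only [hb, hD]
    ring
  constructor
  · set B : ℝ → ℝ := fun x =>
      (x ^ 2 + b x * (1 - x ^ 5)) / (1 + b x * (1 - x ^ 3)) with hB
    have hBc : ContinuousAt B 0 :=
      ContinuousAt.div (by fun_prop) (by fun_prop) (by norm_num; positivity)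
    have hB0 : B 0 = k ^ 2 := by
      simp only [hB, hb0]
      field_simp
      ring
    set H : ℝ → ℝ := fun x => (1 / 2) * B x ^ ((5 : ℝ) / 2)
        * (3 * x ^ 3 * b x ^ 2 * (3 * x ^ 5 - 5 * x ^ 3 + 2)
            + b x * (-9 * x ^ 5 + 5 * x ^ 3 + 4) + 10)
        / (x ^ 3 * b x ^ 2 * (5 * x ^ 8 - 8 * x ^ 5 + 3)
            + b x * (-10 * x ^ 8 + 8 * x ^ 5 + 2) + 5 * x ^ 5) with hH
    have hHc : ContinuousAt H 0 := by
      have hpow : ContinuousAt (fun x => B x ^ ((5 : ℝ) / 2)) 0 :=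
        hBc.rpow_const (Or.inr (by norm_num))
      exact ContinuousAt.div (by fun_prop) (by fun_prop) (by norm_num; exact hbpos.ne')
    have hkpow : (k ^ 2) ^ ((5 : ℝ) / 2) = k ^ 5 := by
      rw [← Real.rpow_natCast, ← Real.rpow_natCast, ← Real.rpow_mul hk0.le]
      norm_num
    have hH0 : H 0 = (1 / 2) * k ^ 3 * (5 - 3 * k ^ 2) := by
      simp only [hH, hB0, hkpow, hb0]
      norm_num
      field_simp
      ring
    rw [← hH0]
    refine (hHc.tendsto.mono_left nhdsWithin_le_nhds).congr' ?_
    filter_upwards [self_mem_nhdsWithin] with x hx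
    have hx3 : x ^ 3 ≠ 0 := pow_ne_zero 3 (ne_of_gt hx)
    rw [hh, hαb]
    simp only [hH, hB]
    rw [← mul_div_mul_left (x ^ 2 + b x * (1 - x ^ 5)) _ hx3, ← mul_div_mul_left _ (_ + _) hx3]
    ring_nf
  · set g : ℝ → ℝ := fun x =>
      (-(1 - k ^ 2) - k ^ 4 * x + k ^ 2 * x ^ 3) / (D x * (1 - k ^ 2)) with hg
    have hgc : ContinuousAt g 0 :=
      ContinuousAt.div (by fun_prop) (by fun_prop) (mul_ne_zero hDne hk2.ne')
    have hO : (fun x => x ^ 5 * g x) =O[nhdsWithin 0 (Ioi 0)] fun x : ℝ => x ^ 5 := by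
      simpa using (isBigO_refl (fun x : ℝ => x ^ 5) _).mul
        ((hgc.tendsto.mono_left nhdsWithin_le_nhds).isBigO_one ℝ)
    refine hO.congr' ?_ EventuallyEq.rfl
    filter_upwards [nhdsWithin_le_nhds (hDc.eventually_ne hDne)] with x hx
    rw [hαb]
    simp only [hg, hb]
    field_simp
    simp only [hD]
    ring
end
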